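/- Let E ⊆ B₁ ⊆ ℝⁿ have finite perimeter and φ_ε = 1_E ∗ γ_{n,ε}. Then both limsup_{ε→0} and liminf_{ε→0} of (1/|log ε|) ‖φ_ε‖²_{H^{1/2}} are comparable, with dimensional constants, to the perimeter ∫_{ℝⁿ} |∇1_E|. -/

import Mathlib

open MeasureTheory Set Real Filter

/-- Divergence of a vector field on `ℝⁿ`. -/
noncomputable def diverg {n : ℕ}
    (φ : EuclideanSpace ℝ (Fin n) → EuclideanSpace ℝ (Fin n))
    (x : EuclideanSpace ℝ (Fin n)) : ℝ :=
  ∑ i : Fin n, fderiv ℝ φ x (EuclideanSpace.single i 1) i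

/-- Values `∫ u · div φ` over smooth compactly supported vector fields with `‖φ‖ ≤ 1`. -/
def varSet {n : ℕ} (u : EuclideanSpace ℝ (Fin n) → ℝ) : Set ℝ :=
  {r | ∃ φ : EuclideanSpace ℝ (Fin n) → EuclideanSpace ℝ (Fin n),
    ContDiff ℝ (⊤ : ℕ∞) φ ∧ HasCompactSupport φ ∧ (∀ x, ‖φ x‖ ≤ 1) ∧
    r = ∫ x, u x * diverg φ x}

/-- The perimeter `∫_{ℝⁿ} |∇1_E|` of a set `E ⊆ ℝⁿ`. -/
noncomputable def perimeter {n : ℕ} (E : Set (EuclideanSpace ℝ (Fin n))) : ℝ :=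
  sSup (varSet (E.indicator (fun _ => (1 : ℝ))))

/-- `E` has finite perimeter. -/
def HasFinitePerimeter {n : ℕ} (E : Set (EuclideanSpace ℝ (Fin n))) : Prop :=
  MeasurableSet E ∧ BddAbove (varSet (E.indicator (fun _ => (1 : ℝ))))

/-- Standard Gaussian density on `ℝⁿ`. -/
noncomputable def gaussian (n : ℕ) (x : EuclideanSpace ℝ (Fin n)) : ℝ :=
  (2 * π) ^ (-(n : ℝ) / 2) * exp (-‖x‖ ^ 2 / 2)

/-- Gaussian mollification `φ_ε = 1_E ∗ γ_{n,ε}`. -/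
noncomputable def mollifyInd {n : ℕ} (E : Set (EuclideanSpace ℝ (Fin n))) (ε : ℝ)
    (x : EuclideanSpace ℝ (Fin n)) : ℝ :=
  ∫ y, E.indicator (fun _ => (1 : ℝ)) (x - y) * (ε ^ (-(n : ℝ)) * gaussian n (ε⁻¹ • y))

/-- The squared `H^{1/2}` norm. -/
noncomputable def H12 {n : ℕ} (v : EuclideanSpace ℝ (Fin n) → ℝ) : ENNReal :=
  ∫⁻ x, ∫⁻ y, ENNReal.ofReal (|v x - v y| ^ 2 / ‖x - y‖ ^ (n + 1))

/-- The characteristic function of a set, as a real function. -/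
noncomputable abbrev charFn {n : ℕ} (E : Set (EuclideanSpace ℝ (Fin n))) :
    EuclideanSpace ℝ (Fin n) → ℝ :=
  E.indicator (fun _ => (1 : ℝ))

section Basic

variable {n : ℕ} {E : Set (EuclideanSpace ℝ (Fin n))}

lemma charFn_nonneg (x : EuclideanSpace ℝ (Fin n)) : 0 ≤ charFn E x :=
  indicator_nonneg (fun _ _ => zero_le_one) x

lemma charFn_le_one (x : EuclideanSpace ℝ (Fin n)) : charFn E x ≤ 1 :=
  indicator_le_self' (fun _ _ => zero_le_one) x

lemma abs_charFn_le_one (x : EuclideanSpace ℝ (Fin n)) : |charFn E x| ≤ 1 := by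
  rw [abs_of_nonneg (charFn_nonneg x)]; exact charFn_le_one x

lemma measurable_charFn (hE : MeasurableSet E) : Measurable (charFn E) :=
  measurable_const.indicator hE

lemma integrable_charFn (hE : MeasurableSet E) (hfin : volume E ≠ ⊤) :
    Integrable (charFn E) :=
  (integrable_indicator_iff hE).2 (integrableOn_const hfin)

lemma integrable_charFn_mul (hE : MeasurableSet E) (hfin : volume E ≠ ⊤)
    {f : EuclideanSpace ℝ (Fin n) → ℝ} (hf : Continuous f) {C : ℝ} (hC : ∀ x, |f x| ≤ C) :
    Integrable (fun x => charFn E x * f x) :=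
  (integrable_charFn hE hfin).mul_bdd hf.aestronglyMeasurable
    (Eventually.of_forall hC)

lemma diverg_smul_const {f : EuclideanSpace ℝ (Fin n) → ℝ} {x : EuclideanSpace ℝ (Fin n)}
    (hf : DifferentiableAt ℝ f x) (h : EuclideanSpace ℝ (Fin n)) :
    diverg (fun y => f y • h) x = fderiv ℝ f x h := by
  have hh : h = ∑ i, h i • EuclideanSpace.single i (1 : ℝ) := by
    simpa using ((EuclideanSpace.basisFun (Fin n) ℝ).sum_repr h).symm
  unfold diverg
  rw [fderiv_smul_const hf]
  conv_rhs => rw [hh, map_sum]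
  refine Finset.sum_congr rfl fun i _ => ?_
  simp [mul_comm]

lemma diverg_const_smul {φ : EuclideanSpace ℝ (Fin n) → EuclideanSpace ℝ (Fin n)}
    (hφ : Differentiable ℝ φ) (c : ℝ) (x : EuclideanSpace ℝ (Fin n)) :
    diverg (fun y => c • φ y) x = c * diverg φ x := by
  unfold diverg
  rw [fderiv_fun_const_smul (hφ x), Finset.mul_sum]
  simp

lemma perimeter_nonneg (hE : HasFinitePerimeter E) : 0 ≤ perimeter E := by
  refine le_csSup hE.2 ⟨fun _ => 0, contDiff_const, HasCompactSupport.zero, by simp, ?_⟩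
  simp [diverg]

lemma integral_mul_diverg_le (hE : HasFinitePerimeter E)
    {φ : EuclideanSpace ℝ (Fin n) → EuclideanSpace ℝ (Fin n)} (hφ : ContDiff ℝ (⊤ : ℕ∞) φ)
    (hc : HasCompactSupport φ) {M : ℝ} (hM : ∀ x, ‖φ x‖ ≤ M) :
    ∫ x, charFn E x * diverg φ x ≤ M * perimeter E := by
  have hM0 : 0 ≤ M := (norm_nonneg _).trans (hM 0)
  rcases hM0.eq_or_lt with rfl | hpos
  · have : φ = fun _ => 0 := by
      funext x
      simpa using hM x
    simp [this, diverg]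
  · have key : ∫ x, charFn E x * diverg (fun y => M⁻¹ • φ y) x ≤ perimeter E := by
      refine le_csSup hE.2 ⟨fun y => M⁻¹ • φ y, hφ.const_smul M⁻¹,
        hc.mono' fun x hx => subset_tsupport _ fun h0 => hx (by simp [h0]),
        fun x => ?_, rfl⟩
      rw [norm_smul, norm_inv, Real.norm_of_nonneg hM0, inv_mul_le_iff₀ hpos]
      simpa using hM x
    have hd : Differentiable ℝ φ := hφ.differentiable (by simp)
    simp_rw [diverg_const_smul hd] at key
    have e : ∀ x, charFn E x * (M⁻¹ * diverg φ x) = M⁻¹ * (charFn E x * diverg φ x) :=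
      fun x => by ring
    simp_rw [e, integral_const_mul] at key
    rwa [inv_mul_le_iff₀ hpos] at key

lemma integral_charFn_mul_translate_sub_le (hE : HasFinitePerimeter E) (hfin : volume E ≠ ⊤)
    {ψ : EuclideanSpace ℝ (Fin n) → ℝ} (hψ : ContDiff ℝ (⊤ : ℕ∞) ψ)
    (hc : HasCompactSupport ψ) (h1 : ∀ x, |ψ x| ≤ 1) (h : EuclideanSpace ℝ (Fin n)) :
    (∫ x, charFn E x * ψ (x - h)) - ∫ x, charFn E x * ψ x ≤ ‖h‖ * perimeter E := by
  have hcont : Continuous (fderiv ℝ ψ) := hψ.continuous_fderiv (by simp)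
  obtain ⟨C, hC⟩ := (hc.fderiv (𝕜 := ℝ)).exists_bound_of_continuous hcont
  have hdiff : Differentiable ℝ ψ := hψ.differentiable (by simp)
  have hline : ∀ (x : EuclideanSpace ℝ (Fin n)) (t : ℝ),
      HasDerivAt (fun t : ℝ => ψ (x - t • h)) (-(fderiv ℝ ψ (x - t • h) h)) t := by
    intro x t
    have h1 : HasDerivAt (fun t : ℝ => x - t • h) (-h) t := by
      simpa using ((hasDerivAt_id t).smul_const h).const_sub x
    have h2 := (hdiff (x - t • h)).hasFDerivAt.comp_hasDerivAt t h1
    rwa [map_neg] at h2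
  have hder : ∀ t : ℝ, HasDerivAt (fun t : ℝ => ∫ x, charFn E x * ψ (x - t • h))
      (∫ x, charFn E x * -(fderiv ℝ ψ (x - t • h) h)) t := by
    intro t
    refine (hasDerivAt_integral_of_dominated_loc_of_deriv_le (s := Set.univ)
      (bound := fun x => charFn E x * (C * ‖h‖)) univ_mem
      (Eventually.of_forall fun s => ?_) ?_ ?_ (Eventually.of_forall fun x s _ => ?_) ?_
      (Eventually.of_forall fun x s _ => (hline x s).const_mul _)).2
    · exact ((measurable_charFn hE.1).mul
        (hψ.continuous.comp (by fun_prop)).measurable).aestronglyMeasurable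
    · exact integrable_charFn_mul hE.1 hfin (hψ.continuous.comp (by fun_prop)) fun x => h1 _
    · refine ((measurable_charFn hE.1).mul ?_).aestronglyMeasurable
      exact (Continuous.neg ((hcont.comp (by fun_prop)).clm_apply continuous_const)).measurable
    · rw [norm_mul, Real.norm_of_nonneg (charFn_nonneg x), norm_neg]
      exact mul_le_mul_of_nonneg_left ((ContinuousLinearMap.le_opNorm _ _).trans
        (mul_le_mul_of_nonneg_right (hC _) (norm_nonneg _))) (charFn_nonneg x)
    · exact (integrable_charFn hE.1 hfin).mul_const _
  have hle : ∀ t : ℝ, ∫ x, charFn E x * -(fderiv ℝ ψ (x - t • h) h) ≤ ‖h‖ * perimeter E := by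
    intro t
    have hd : ContDiff ℝ (⊤ : ℕ∞) (fun x => -ψ (x - t • h)) :=
      (hψ.comp (contDiff_id.sub contDiff_const)).neg
    have hcs : HasCompactSupport (fun x => -ψ (x - t • h)) := by
      have := hc.comp_homeomorph (Homeomorph.subRight (t • h))
      exact this.neg
    have := integral_mul_diverg_le hE (φ := fun x => (-ψ (x - t • h)) • h)
      (hd.smul contDiff_const) hcs.smul_right (M := ‖h‖) (fun x => by
        rw [norm_smul, norm_neg, Real.norm_eq_abs]
        exact mul_le_of_le_one_left (norm_nonneg _) (h1 _))
    refine le_trans (le_of_eq ?_) this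
    congr 1
    funext x
    rw [diverg_smul_const (hd.differentiable (by simp) x), fderiv_fun_neg,
      fderiv_comp_sub (f := ψ)]
    simp
  have := Convex.image_sub_le_mul_sub_of_deriv_le (convex_Icc (0 : ℝ) 1)
    (f := fun t : ℝ => ∫ x, charFn E x * ψ (x - t • h))
    (fun t _ => (hder t).continuousAt.continuousWithinAt)
    (fun t _ => (hder t).differentiableAt.differentiableWithinAt)
    (C := ‖h‖ * perimeter E) (fun t _ => by rw [(hder t).deriv]; exact hle t)
    0 (by simp) 1 (by simp) zero_le_one
  simpa using this

lemma abs_charFn_sub_sq (x y : EuclideanSpace ℝ (Fin n)) :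
    (charFn E x - charFn E y) * (charFn E x - charFn E y) = |charFn E x - charFn E y| := by
  by_cases hx : x ∈ E <;> by_cases hy : y ∈ E <;> simp [charFn, hx, hy]

lemma abs_charFn_sub_le_one (x y : EuclideanSpace ℝ (Fin n)) :
    |charFn E x - charFn E y| ≤ 1 := by
  by_cases hx : x ∈ E <;> by_cases hy : y ∈ E <;> simp [charFn, hx, hy]

lemma integrable_charFn_translate_sub (hE : MeasurableSet E) (hfin : volume E ≠ ⊤)
    (h : EuclideanSpace ℝ (Fin n)) : Integrable (fun x => charFn E (x + h) - charFn E x) :=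
  ((integrable_charFn hE hfin).comp_add_right h).sub (integrable_charFn hE hfin)

lemma integral_translate_sub_mul (hE : MeasurableSet E) (hfin : volume E ≠ ⊤)
    {ψ : EuclideanSpace ℝ (Fin n) → ℝ} (hψ : Continuous ψ) {C : ℝ} (h1 : ∀ x, |ψ x| ≤ C)
    (h : EuclideanSpace ℝ (Fin n)) :
    ∫ x, (charFn E (x + h) - charFn E x) * ψ x =
      (∫ x, charFn E x * ψ (x - h)) - ∫ x, charFn E x * ψ x := by
  have e := integral_add_right_eq_self (μ := volume) (fun x => charFn E x * ψ (x - h)) h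
  simp only [add_sub_cancel_right] at e
  rw [← e, ← integral_sub _ (integrable_charFn_mul hE hfin hψ h1)]
  · simp only [sub_mul]
  · exact ((integrable_charFn hE hfin).comp_add_right h).mul_bdd hψ.aestronglyMeasurable
      (Eventually.of_forall h1)

lemma integral_abs_translate_sub_le (hE : HasFinitePerimeter E) (hb : E ⊆ Metric.ball 0 1)
    (h : EuclideanSpace ℝ (Fin n)) :
    ∫ x, |charFn E (x + h) - charFn E x| ≤ ‖h‖ * perimeter E := by
  have hfin : volume E ≠ ⊤ := measure_ne_top_of_subset hb measure_ball_lt_top.ne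
  set w := fun x => charFn E (x + h) - charFn E x with hw
  have hwi : Integrable w := integrable_charFn_translate_sub hE.1 hfin h
  have hw1 : ∀ x, |w x| ≤ 1 := fun x => abs_charFn_sub_le_one _ _
  have hcE : HasCompactSupport (charFn E) :=
    HasCompactSupport.intro (isCompact_closedBall (0 : EuclideanSpace ℝ (Fin n)) 1) fun x hx =>
      indicator_of_notMem (fun hxE => hx (Metric.ball_subset_closedBall (hb hxE))) _
  have hcw : HasCompactSupport w :=
    (hcE.comp_homeomorph (Homeomorph.addRight h)).sub hcE
  let φ : ℕ → ContDiffBump (0 : EuclideanSpace ℝ (Fin n)) := fun k =>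
    ⟨1 / ((k : ℝ) + 1), 2 * (1 / ((k : ℝ) + 1)), by positivity, by
      have : 0 < 1 / ((k : ℝ) + 1) := by positivity
      linarith⟩
  let ψ : ℕ → EuclideanSpace ℝ (Fin n) → ℝ := fun k =>
    convolution ((φ k).normed volume) w (ContinuousLinearMap.lsmul ℝ ℝ) volume
  have hlim : ∀ᵐ x, Tendsto (fun k => ψ k x) atTop (nhds (w x)) := by
    refine ContDiffBump.ae_convolution_tendsto_right_of_locallyIntegrable (K := 2) ?_
      (Eventually.of_forall fun k => le_rfl) hwi.locallyIntegrable
    have := (tendsto_one_div_add_atTop_nhds_zero_nat (𝕜 := ℝ)).const_mul 2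
    rwa [mul_zero] at this
  have hψ1 : ∀ k x, |ψ k x| ≤ 1 := by
    intro k x
    have := norm_integral_le_of_norm_le (μ := volume) (f := fun t => (φ k).normed volume t • w (x - t))
      (g := (φ k).normed volume) (φ k).integrable_normed (Eventually.of_forall fun t => by
        rw [norm_smul, Real.norm_of_nonneg ((φ k).nonneg_normed t)]
        exact mul_le_of_le_one_right ((φ k).nonneg_normed t) (hw1 _))
    rw [(φ k).integral_normed] at this
    exact this
  have hψs : ∀ k, ContDiff ℝ (⊤ : ℕ∞) (ψ k) := fun k =>
    HasCompactSupport.contDiff_convolution_left _ (φ k).hasCompactSupport_normed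
      (φ k).contDiff_normed hwi.locallyIntegrable
  have hψc : ∀ k, HasCompactSupport (ψ k) := fun k =>
    HasCompactSupport.convolution _ (φ k).hasCompactSupport_normed hcw
  have hT : Tendsto (fun k => ∫ x, w x * ψ k x) atTop (nhds (∫ x, w x * w x)) := by
    refine tendsto_integral_of_dominated_convergence (fun x => |w x|) (fun k =>
      hwi.aestronglyMeasurable.mul (hψs k).continuous.aestronglyMeasurable) hwi.abs
      (fun k => Eventually.of_forall fun x => ?_) ?_
    · rw [norm_mul]
      exact mul_le_of_le_one_right (norm_nonneg _) (hψ1 k x)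
    · filter_upwards [hlim] with x hx using hx.const_mul _
  have e : ∫ x, |w x| = ∫ x, w x * w x :=
    integral_congr_ae (Eventually.of_forall fun x => (abs_charFn_sub_sq _ _).symm)
  change ∫ x, |w x| ≤ _
  rw [e]
  refine le_of_tendsto' hT fun k => ?_
  rw [hw, integral_translate_sub_mul hE.1 hfin (hψs k).continuous (hψ1 k)]
  exact integral_charFn_mul_translate_sub_le hE hfin (hψs k) (hψc k) (hψ1 k) h

end Basic

section Kernel

variable {n : ℕ}

/-- The rescaled Gaussian density `x ↦ ε⁻ⁿ γₙ(x / ε)`. -/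
noncomputable def gaussKernel (n : ℕ) (ε : ℝ) (y : EuclideanSpace ℝ (Fin n)) : ℝ :=
  ε ^ (-(n : ℝ)) * gaussian n (ε⁻¹ • y)

lemma gaussian_nonneg (x : EuclideanSpace ℝ (Fin n)) : 0 ≤ gaussian n x := by
  unfold gaussian; positivity

lemma continuous_gaussian : Continuous (gaussian n) := by
  unfold gaussian; fun_prop

lemma integrable_exp_neg_mul_sq_norm {b : ℝ} (hb : 0 < b) :
    Integrable (fun x : EuclideanSpace ℝ (Fin n) => exp (-b * ‖x‖ ^ 2)) := by
  refine Integrable.of_integral_ne_zero ?_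
  rw [GaussianFourier.integral_rexp_neg_mul_sq_norm hb]
  positivity

lemma gaussian_eq (x : EuclideanSpace ℝ (Fin n)) :
    gaussian n x = (2 * π) ^ (-(n : ℝ) / 2) * exp (-(1 / 2) * ‖x‖ ^ 2) := by
  unfold gaussian; congr 2; ring

lemma integrable_gaussian : Integrable (gaussian n) := by
  simp_rw [funext gaussian_eq]
  exact (integrable_exp_neg_mul_sq_norm (by norm_num)).const_mul _

lemma integral_gaussian_eq_one : ∫ x, gaussian n x = 1 := by
  simp_rw [gaussian_eq]
  rw [integral_const_mul, GaussianFourier.integral_rexp_neg_mul_sq_norm (by norm_num),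
    finrank_euclideanSpace_fin, show π / (1 / 2) = 2 * π by ring,
    ← rpow_add (by positivity)]
  simp [neg_div]

lemma integrable_norm_mul_gaussian :
    Integrable (fun x : EuclideanSpace ℝ (Fin n) => ‖x‖ * gaussian n x) := by
  refine Integrable.mono' ((integrable_exp_neg_mul_sq_norm (n := n) (b := 1 / 4)
    (by norm_num)).const_mul ((2 * π) ^ (-(n : ℝ) / 2)))
    (continuous_norm.mul continuous_gaussian).aestronglyMeasurable
    (Eventually.of_forall fun x => ?_)
  rw [Real.norm_of_nonneg (mul_nonneg (norm_nonneg _) (gaussian_nonneg x)), gaussian_eq,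
    mul_left_comm]
  gcongr
  have h1 : ‖x‖ ≤ exp (1 / 4 * ‖x‖ ^ 2) := by
    have := add_one_le_exp (1 / 4 * ‖x‖ ^ 2)
    nlinarith [sq_nonneg (‖x‖ / 2 - 1)]
  calc ‖x‖ * exp (-(1 / 2) * ‖x‖ ^ 2)
      ≤ exp (1 / 4 * ‖x‖ ^ 2) * exp (-(1 / 2) * ‖x‖ ^ 2) := by gcongr
    _ = exp (-(1 / 4) * ‖x‖ ^ 2) := by rw [← exp_add]; ring_nf

lemma abs_exp_neg_sq_sub_le (s t : ℝ) : |exp (-s ^ 2 / 2) - exp (-t ^ 2 / 2)| ≤ |s - t| := by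
  have hd : ∀ t : ℝ, HasDerivAt (fun t : ℝ => exp (-t ^ 2 / 2)) (exp (-t ^ 2 / 2) * (-t)) t := by
    intro t
    convert (((hasDerivAt_pow 2 t).fun_neg.div_const 2).exp) using 1
    ring
  have := Convex.norm_image_sub_le_of_norm_hasDerivWithin_le (s := univ) (C := 1)
    (fun t _ => (hd t).hasDerivWithinAt) (fun t _ => ?_) convex_univ (mem_univ t) (mem_univ s)
  · simpa using this
  · rw [norm_mul, norm_neg, Real.norm_of_nonneg (exp_pos _).le, Real.norm_eq_abs]
    have h1 : |t| ≤ exp (t ^ 2 / 2) := by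
      have := add_one_le_exp (t ^ 2 / 2)
      nlinarith [sq_nonneg (|t| - 1), sq_abs t]
    calc exp (-t ^ 2 / 2) * |t| ≤ exp (-t ^ 2 / 2) * exp (t ^ 2 / 2) := by gcongr
      _ = 1 := by rw [← exp_add]; ring_nf; simp

lemma abs_gaussian_sub_le (x y : EuclideanSpace ℝ (Fin n)) :
    |gaussian n x - gaussian n y| ≤ (2 * π) ^ (-(n : ℝ) / 2) * ‖x - y‖ := by
  unfold gaussian
  rw [← mul_sub, abs_mul, abs_of_nonneg (by positivity : 0 ≤ (2 * π) ^ (-(n : ℝ) / 2))]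
  gcongr
  exact (abs_exp_neg_sq_sub_le _ _).trans (abs_norm_sub_norm_le x y)

variable {ε : ℝ}

lemma gaussKernel_nonneg (hε : 0 < ε) (y : EuclideanSpace ℝ (Fin n)) :
    0 ≤ gaussKernel n ε y :=
  mul_nonneg (by positivity) (gaussian_nonneg _)

lemma continuous_gaussKernel : Continuous (gaussKernel n ε) :=
  continuous_const.mul (continuous_gaussian.comp (continuous_const_smul _))

lemma integrable_gaussKernel (hε : 0 < ε) : Integrable (gaussKernel n ε) :=
  (integrable_gaussian.comp_smul (inv_ne_zero hε.ne')).const_mul _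

lemma integral_gaussKernel (hε : 0 < ε) : ∫ y, gaussKernel n ε y = 1 := by
  unfold gaussKernel
  rw [integral_const_mul, Measure.integral_comp_inv_smul, integral_gaussian_eq_one,
    finrank_euclideanSpace_fin, abs_of_pos (by positivity), smul_eq_mul, mul_one,
    rpow_neg hε.le, rpow_natCast, inv_mul_cancel₀ (by positivity)]

lemma norm_mul_gaussKernel (hε : 0 < ε) (y : EuclideanSpace ℝ (Fin n)) :
    ‖y‖ * gaussKernel n ε y =
      ε * ε ^ (-(n : ℝ)) * (‖ε⁻¹ • y‖ * gaussian n (ε⁻¹ • y)) := by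
  rw [gaussKernel, norm_smul, Real.norm_of_nonneg (by positivity : 0 ≤ ε⁻¹)]
  field_simp

lemma integrable_norm_mul_gaussKernel (hε : 0 < ε) :
    Integrable (fun y : EuclideanSpace ℝ (Fin n) => ‖y‖ * gaussKernel n ε y) := by
  simp_rw [norm_mul_gaussKernel hε]
  exact (integrable_norm_mul_gaussian.comp_smul (inv_ne_zero hε.ne')).const_mul _

lemma integral_norm_mul_gaussKernel (hε : 0 < ε) :
    ∫ y : EuclideanSpace ℝ (Fin n), ‖y‖ * gaussKernel n ε y =
      ε * ∫ y : EuclideanSpace ℝ (Fin n), ‖y‖ * gaussian n y := by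
  simp_rw [norm_mul_gaussKernel hε]
  rw [integral_const_mul, Measure.integral_comp_inv_smul volume (fun y => ‖y‖ * gaussian n y),
    finrank_euclideanSpace_fin, abs_of_pos (by positivity), smul_eq_mul,
    rpow_neg hε.le, rpow_natCast]
  field_simp

lemma abs_gaussKernel_sub_le (hε : 0 < ε) (x y : EuclideanSpace ℝ (Fin n)) :
    |gaussKernel n ε x - gaussKernel n ε y| ≤
      (2 * π) ^ (-(n : ℝ) / 2) * (ε ^ (n + 1))⁻¹ * ‖x - y‖ := by
  unfold gaussKernel
  rw [← mul_sub, abs_mul, abs_of_pos (by positivity : 0 < ε ^ (-(n : ℝ)))]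
  calc _ ≤ ε ^ (-(n : ℝ)) * ((2 * π) ^ (-(n : ℝ) / 2) * ‖ε⁻¹ • x - ε⁻¹ • y‖) := by
        gcongr; exact abs_gaussian_sub_le _ _
    _ = _ := by
        rw [← smul_sub, norm_smul, Real.norm_of_nonneg (by positivity : 0 ≤ ε⁻¹),
          rpow_neg hε.le, rpow_natCast, pow_succ, mul_inv]
        ring

end Kernel

section Mollify

variable {n : ℕ} {E : Set (EuclideanSpace ℝ (Fin n))} {ε : ℝ}

lemma integrable_charFn_sub_mul_gaussKernel (hE : MeasurableSet E) (hε : 0 < ε)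
    (x : EuclideanSpace ℝ (Fin n)) :
    Integrable (fun y => charFn E (x - y) * gaussKernel n ε y) :=
  (integrable_gaussKernel hε).bdd_mul
    ((measurable_charFn hE).comp (measurable_const.sub measurable_id)).aestronglyMeasurable
    (Eventually.of_forall fun _ => abs_charFn_le_one _)

lemma mollifyInd_eq (x : EuclideanSpace ℝ (Fin n)) :
    mollifyInd E ε x = ∫ y, charFn E y * gaussKernel n ε (x - y) := by
  rw [← integral_sub_left_eq_self _ volume x]
  simp only [sub_sub_cancel]
  rfl

lemma mollifyInd_sub (hE : MeasurableSet E) (hε : 0 < ε) (x x' : EuclideanSpace ℝ (Fin n)) :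
    mollifyInd E ε x - mollifyInd E ε x' =
      ∫ y, (charFn E (x - y) - charFn E (x' - y)) * gaussKernel n ε y := by
  simp_rw [sub_mul]
  rw [integral_sub (integrable_charFn_sub_mul_gaussKernel hE hε x)
    (integrable_charFn_sub_mul_gaussKernel hE hε x')]
  rfl

lemma charFn_sub_mollifyInd (hE : MeasurableSet E) (hε : 0 < ε)
    (x : EuclideanSpace ℝ (Fin n)) :
    charFn E x - mollifyInd E ε x =
      ∫ y, (charFn E x - charFn E (x - y)) * gaussKernel n ε y := by
  simp_rw [sub_mul]
  rw [integral_sub ((integrable_gaussKernel hε).const_mul _)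
    (integrable_charFn_sub_mul_gaussKernel hE hε x), integral_const_mul,
    integral_gaussKernel hε, mul_one]
  rfl

lemma abs_integral_mul_gaussKernel_le_one (hε : 0 < ε) {f : EuclideanSpace ℝ (Fin n) → ℝ}
    (hf : ∀ y, |f y| ≤ 1) : |∫ y, f y * gaussKernel n ε y| ≤ 1 := by
  rw [← integral_gaussKernel (n := n) hε, ← Real.norm_eq_abs]
  refine norm_integral_le_of_norm_le (integrable_gaussKernel hε) (Eventually.of_forall fun y => ?_)
  rw [norm_mul, Real.norm_of_nonneg (gaussKernel_nonneg hε y)]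
  exact mul_le_of_le_one_left (gaussKernel_nonneg hε y) (hf y)

lemma abs_mollifyInd_sub_le_one (hE : MeasurableSet E) (hε : 0 < ε)
    (x x' : EuclideanSpace ℝ (Fin n)) : |mollifyInd E ε x - mollifyInd E ε x'| ≤ 1 := by
  rw [mollifyInd_sub hE hε]
  exact abs_integral_mul_gaussKernel_le_one hε fun y => abs_charFn_sub_le_one _ _

lemma abs_charFn_sub_mollifyInd_le_one (hE : MeasurableSet E) (hε : 0 < ε)
    (x : EuclideanSpace ℝ (Fin n)) : |charFn E x - mollifyInd E ε x| ≤ 1 := by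
  rw [charFn_sub_mollifyInd hE hε]
  exact abs_integral_mul_gaussKernel_le_one hε fun y => abs_charFn_sub_le_one _ _

lemma abs_mollifyInd_sub_le (hE : MeasurableSet E) (hb : E ⊆ Metric.ball 0 1) (hε : 0 < ε)
    (x x' : EuclideanSpace ℝ (Fin n)) :
    |mollifyInd E ε x - mollifyInd E ε x'| ≤
      volume.real (Metric.ball (0 : EuclideanSpace ℝ (Fin n)) 1) * (2 * π) ^ (-(n : ℝ) / 2) *
        (ε ^ (n + 1))⁻¹ * ‖x - x'‖ := by
  have hfin : volume E ≠ ⊤ := measure_ne_top_of_subset hb measure_ball_lt_top.ne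
  have hint : ∀ x, Integrable (fun y => charFn E y * gaussKernel n ε (x - y)) := fun x =>
    ((integrable_gaussKernel hε).comp_sub_left x).bdd_mul
      (measurable_charFn hE).aestronglyMeasurable
      (Eventually.of_forall fun _ => abs_charFn_le_one _)
  rw [mollifyInd_eq, mollifyInd_eq, ← integral_sub (hint x) (hint x')]
  set K := (2 * π) ^ (-(n : ℝ) / 2) * (ε ^ (n + 1))⁻¹ * ‖x - x'‖ with hK
  have hK0 : 0 ≤ K := by positivity
  calc _ ≤ ∫ y, charFn E y * K := by
        rw [← Real.norm_eq_abs]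
        refine norm_integral_le_of_norm_le ((integrable_charFn hE hfin).mul_const _)
          (Eventually.of_forall fun y => ?_)
        rw [← mul_sub, norm_mul, Real.norm_of_nonneg (charFn_nonneg y)]
        refine mul_le_mul_of_nonneg_left ?_ (charFn_nonneg y)
        simpa using abs_gaussKernel_sub_le hε (x - y) (x' - y)
    _ = volume.real E * K := by
        rw [integral_mul_const, charFn, integral_indicator_const _ hE]; simp
    _ ≤ volume.real (Metric.ball (0 : EuclideanSpace ℝ (Fin n)) 1) * K := by
        gcongr
        exact measure_ball_lt_top.ne
    _ = _ := by rw [hK]; ring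

lemma continuous_mollifyInd (hE : MeasurableSet E) (hb : E ⊆ Metric.ball 0 1) (hε : 0 < ε) :
    Continuous (mollifyInd E ε) :=
  (LipschitzWith.of_dist_le' fun x x' => by
    rw [Real.dist_eq, dist_eq_norm]
    exact abs_mollifyInd_sub_le hE hb hε x x').continuous

end Mollify

section Translates

variable {n : ℕ} {E : Set (EuclideanSpace ℝ (Fin n))} {ε : ℝ}

lemma lintegral_enorm_translate_sub_le (hE : HasFinitePerimeter E) (hb : E ⊆ Metric.ball 0 1)
    (h : EuclideanSpace ℝ (Fin n)) :
    ∫⁻ x, ‖charFn E (x + h) - charFn E x‖ₑ ≤ ENNReal.ofReal (‖h‖ * perimeter E) := by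
  have hfin : volume E ≠ ⊤ := measure_ne_top_of_subset hb measure_ball_lt_top.ne
  rw [← ofReal_integral_norm_eq_lintegral_enorm (integrable_charFn_translate_sub hE.1 hfin h)]
  exact ENNReal.ofReal_le_ofReal (integral_abs_translate_sub_le hE hb h)

lemma lintegral_enorm_translate_sub_le_volume (hE : MeasurableSet E)
    (hb : E ⊆ Metric.ball 0 1) (h : EuclideanSpace ℝ (Fin n)) :
    ∫⁻ x, ‖charFn E (x + h) - charFn E x‖ₑ ≤
      2 * volume (Metric.ball (0 : EuclideanSpace ℝ (Fin n)) 1) := by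
  have e : ∫⁻ x, ‖charFn E x‖ₑ = volume E := by
    have : (fun x => ‖charFn E x‖ₑ) = E.indicator (fun _ => (1 : ENNReal)) := by
      funext x
      by_cases hx : x ∈ E <;> simp [charFn, hx]
    rw [this, lintegral_indicator_const hE, one_mul]
  calc ∫⁻ x, ‖charFn E (x + h) - charFn E x‖ₑ
      ≤ ∫⁻ x, (‖charFn E (x + h)‖ₑ + ‖charFn E x‖ₑ) := lintegral_mono fun x => enorm_sub_le
    _ = (∫⁻ x, ‖charFn E (x + h)‖ₑ) + ∫⁻ x, ‖charFn E x‖ₑ :=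
        lintegral_add_right _ (measurable_charFn hE).enorm
    _ = 2 * volume E := by
        rw [lintegral_add_right_eq_self (fun x => ‖charFn E x‖ₑ), e, two_mul]
    _ ≤ _ := by gcongr

lemma lintegral_gaussKernel (hε : 0 < ε) :
    ∫⁻ y, ENNReal.ofReal (gaussKernel n ε y) = 1 := by
  rw [← ofReal_integral_eq_lintegral_ofReal (integrable_gaussKernel hε)
    (Eventually.of_forall (gaussKernel_nonneg hε)), integral_gaussKernel hε, ENNReal.ofReal_one]

lemma enorm_integral_mul_gaussKernel_le (hε : 0 < ε) (f : EuclideanSpace ℝ (Fin n) → ℝ) :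
    ‖∫ y, f y * gaussKernel n ε y‖ₑ ≤
      ∫⁻ y, ‖f y‖ₑ * ENNReal.ofReal (gaussKernel n ε y) := by
  refine (enorm_integral_le_lintegral_enorm _).trans (le_of_eq ?_)
  congr 1
  funext y
  rw [enorm_mul, Real.enorm_of_nonneg (gaussKernel_nonneg hε y)]

lemma lintegral_enorm_mollifyInd_sub_le (hE : MeasurableSet E) (hε : 0 < ε)
    (h : EuclideanSpace ℝ (Fin n)) :
    ∫⁻ x, ‖mollifyInd E ε (x + h) - mollifyInd E ε x‖ₑ ≤
      ∫⁻ x, ‖charFn E (x + h) - charFn E x‖ₑ := by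
  have hm := measurable_charFn hE
  have hk : Measurable (gaussKernel n ε) := continuous_gaussKernel.measurable
  calc ∫⁻ x, ‖mollifyInd E ε (x + h) - mollifyInd E ε x‖ₑ
      ≤ ∫⁻ x, ∫⁻ y, ‖charFn E (x + h - y) - charFn E (x - y)‖ₑ *
          ENNReal.ofReal (gaussKernel n ε y) := by
        refine lintegral_mono fun x => ?_
        rw [mollifyInd_sub hE hε]
        exact enorm_integral_mul_gaussKernel_le hε _
    _ = ∫⁻ y, ∫⁻ x, ‖charFn E (x + h - y) - charFn E (x - y)‖ₑ *
          ENNReal.ofReal (gaussKernel n ε y) := by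
        refine lintegral_lintegral_swap (Measurable.aemeasurable ?_)
        unfold Function.uncurry
        fun_prop
    _ = ∫⁻ y, (∫⁻ x, ‖charFn E (x + h) - charFn E x‖ₑ) *
          ENNReal.ofReal (gaussKernel n ε y) := by
        congr 1
        funext y
        rw [lintegral_mul_const _ (by fun_prop)]
        congr 1
        rw [← lintegral_sub_right_eq_self (fun x => ‖charFn E (x + h) - charFn E x‖ₑ) y]
        congr 1
        funext x
        rw [sub_add_eq_add_sub]
    _ = _ := by
        rw [lintegral_const_mul _ (by fun_prop), lintegral_gaussKernel hε, mul_one]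

lemma lintegral_enorm_charFn_sub_mollifyInd_le (hE : HasFinitePerimeter E)
    (hb : E ⊆ Metric.ball 0 1) (hε : 0 < ε) :
    ∫⁻ x, ‖charFn E x - mollifyInd E ε x‖ₑ ≤ ENNReal.ofReal
      (perimeter E * (ε * ∫ y : EuclideanSpace ℝ (Fin n), ‖y‖ * gaussian n y)) := by
  have hm := measurable_charFn hE.1
  have hk : Measurable (gaussKernel n ε) := continuous_gaussKernel.measurable
  calc ∫⁻ x, ‖charFn E x - mollifyInd E ε x‖ₑ
      ≤ ∫⁻ x, ∫⁻ y, ‖charFn E x - charFn E (x - y)‖ₑ *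
          ENNReal.ofReal (gaussKernel n ε y) := by
        refine lintegral_mono fun x => ?_
        rw [charFn_sub_mollifyInd hE.1 hε]
        exact enorm_integral_mul_gaussKernel_le hε _
    _ = ∫⁻ y, ∫⁻ x, ‖charFn E x - charFn E (x - y)‖ₑ *
          ENNReal.ofReal (gaussKernel n ε y) := by
        refine lintegral_lintegral_swap (Measurable.aemeasurable ?_)
        unfold Function.uncurry
        fun_prop
    _ ≤ ∫⁻ y, ENNReal.ofReal (perimeter E * (‖y‖ * gaussKernel n ε y)) := by
        refine lintegral_mono fun y => ?_
        rw [lintegral_mul_const _ (by fun_prop), ← mul_assoc,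
          ENNReal.ofReal_mul (mul_nonneg (perimeter_nonneg hE) (norm_nonneg _))]
        gcongr
        have := lintegral_enorm_translate_sub_le hE hb (-y)
        rw [norm_neg, mul_comm] at this
        refine le_trans (le_of_eq (lintegral_congr fun x => ?_)) this
        rw [← sub_eq_add_neg, enorm_sub_rev]
    _ = _ := by
        rw [← ofReal_integral_eq_lintegral_ofReal
          ((integrable_norm_mul_gaussKernel hε).const_mul _)
          (Eventually.of_forall fun y => mul_nonneg (perimeter_nonneg hE)
            (mul_nonneg (norm_nonneg _) (gaussKernel_nonneg hε y))),
          integral_const_mul, integral_norm_mul_gaussKernel hε]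

lemma H12_eq_lintegral_translate {v : EuclideanSpace ℝ (Fin n) → ℝ} (hv : Measurable v) :
    H12 v = ∫⁻ h, (∫⁻ x, ‖v (x + h) - v x‖ₑ ^ 2) *
      ENNReal.ofReal ((‖h‖ ^ (n + 1))⁻¹) := by
  have e : ∀ x y, ENNReal.ofReal (|v x - v y| ^ 2 / ‖x - y‖ ^ (n + 1)) =
      ‖v y - v x‖ₑ ^ 2 * ENNReal.ofReal ((‖x - y‖ ^ (n + 1))⁻¹) := by
    intro x y
    rw [div_eq_mul_inv, ENNReal.ofReal_mul (by positivity), ENNReal.ofReal_pow (abs_nonneg _),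
      abs_sub_comm, ← Real.enorm_eq_ofReal_abs]
  unfold H12
  calc _ = ∫⁻ x, ∫⁻ h, ‖v (x + h) - v x‖ₑ ^ 2 * ENNReal.ofReal ((‖h‖ ^ (n + 1))⁻¹) := by
        refine lintegral_congr fun x => ?_
        rw [← lintegral_add_left_eq_self _ x]
        refine lintegral_congr fun h => ?_
        rw [e, sub_add_cancel_left, norm_neg]
    _ = ∫⁻ h, ∫⁻ x, ‖v (x + h) - v x‖ₑ ^ 2 * ENNReal.ofReal ((‖h‖ ^ (n + 1))⁻¹) := by
        refine lintegral_lintegral_swap (Measurable.aemeasurable ?_)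
        unfold Function.uncurry
        fun_prop
    _ = _ := by
        refine lintegral_congr fun h => ?_
        rw [lintegral_mul_const _ (by fun_prop)]

end Translates

section Radial

variable {n : ℕ}

lemma integrableOn_setIntegral_radial (hn : 0 < n) {S : Set ℝ} (hS : MeasurableSet S)
    (hS0 : S ⊆ Ioi 0) {f : ℝ → ℝ} (hint : IntegrableOn (fun y => y ^ (n - 1) * f y) S) :
    IntegrableOn (fun x : EuclideanSpace ℝ (Fin n) => f ‖x‖) {x | ‖x‖ ∈ S} ∧
      ∫ x in {x : EuclideanSpace ℝ (Fin n) | ‖x‖ ∈ S}, f ‖x‖ =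
        n * volume.real (Metric.ball (0 : EuclideanSpace ℝ (Fin n)) 1) *
          ∫ y in S, y ^ (n - 1) * f y := by
  have : Nonempty (Fin n) := ⟨⟨0, hn⟩⟩
  have hA : MeasurableSet {x : EuclideanSpace ℝ (Fin n) | ‖x‖ ∈ S} := measurable_norm hS
  have e1 : {x : EuclideanSpace ℝ (Fin n) | ‖x‖ ∈ S}.indicator (fun x => f ‖x‖) =
      fun x => S.indicator f ‖x‖ := by
    funext x
    by_cases hx : ‖x‖ ∈ S <;> simp [indicator, hx]
  have e2 : (fun y : ℝ => y ^ (n - 1) • S.indicator f y) =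
      S.indicator (fun y => y ^ (n - 1) * f y) := by
    funext y
    by_cases hy : y ∈ S <;> simp [hy]
  constructor
  · rw [← integrable_indicator_iff hA, e1,
      integrable_fun_norm_addHaar volume (f := S.indicator f), finrank_euclideanSpace_fin, e2,
      IntegrableOn, integrable_indicator_iff hS, IntegrableOn, Measure.restrict_restrict hS,
      inter_eq_left.2 hS0]
    exact hint
  · rw [← integral_indicator hA, e1, integral_fun_norm_addHaar volume (S.indicator f),
      finrank_euclideanSpace_fin, e2, setIntegral_indicator hS, inter_eq_right.2 hS0]
    simp [mul_assoc]

lemma setLIntegral_radial (hn : 0 < n) {S : Set ℝ} (hS : MeasurableSet S)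
    (hS0 : S ⊆ Ioi 0) {f : ℝ → ℝ} (hf : ∀ y ∈ S, 0 ≤ f y)
    (hint : IntegrableOn (fun y => y ^ (n - 1) * f y) S) :
    ∫⁻ x in {x : EuclideanSpace ℝ (Fin n) | ‖x‖ ∈ S}, ENNReal.ofReal (f ‖x‖) =
      ENNReal.ofReal (n * volume.real (Metric.ball (0 : EuclideanSpace ℝ (Fin n)) 1) *
          ∫ y in S, y ^ (n - 1) * f y) := by
  have hA : MeasurableSet {x : EuclideanSpace ℝ (Fin n) | ‖x‖ ∈ S} := measurable_norm hS
  obtain ⟨h1, h2⟩ := integrableOn_setIntegral_radial hn hS hS0 hint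
  rw [← h2, ofReal_integral_eq_lintegral_ofReal h1]
  filter_upwards [ae_restrict_mem hA] with x hx using hf _ hx

lemma pow_mul_mul_inv_pow (hn : 0 < n) {y : ℝ} (hy : 0 < y) :
    y ^ (n - 1) * (y * (y ^ (n + 1))⁻¹) = y⁻¹ := by
  obtain ⟨m, rfl⟩ := Nat.exists_eq_succ_of_ne_zero hn.ne'
  simp only [Nat.succ_eq_add_one, Nat.add_sub_cancel]
  field_simp
  ring

lemma pow_mul_sq_mul_inv_pow (hn : 0 < n) {y : ℝ} (hy : 0 < y) :
    y ^ (n - 1) * (y ^ 2 * (y ^ (n + 1))⁻¹) = 1 := by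
  have := pow_mul_mul_inv_pow hn hy
  rw [show y ^ (n - 1) * (y ^ 2 * (y ^ (n + 1))⁻¹) =
    y * (y ^ (n - 1) * (y * (y ^ (n + 1))⁻¹)) by ring, this, mul_inv_cancel₀ hy.ne']

lemma pow_mul_inv_pow (hn : 0 < n) {y : ℝ} (hy : 0 < y) :
    y ^ (n - 1) * (y ^ (n + 1))⁻¹ = y ^ (-2 : ℝ) := by
  have := pow_mul_mul_inv_pow hn hy
  rw [show (-2 : ℝ) = -((2 : ℕ) : ℝ) by norm_num, rpow_neg hy.le, rpow_natCast]
  field_simp at this ⊢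
  linarith

lemma integrableOn_and_integral_sq (hn : 0 < n) {a : ℝ} (ha : 0 < a) :
    IntegrableOn (fun y : ℝ => y ^ (n - 1) * (y ^ 2 * (y ^ (n + 1))⁻¹)) (Ioo 0 a) ∧
      ∫ y in Ioo 0 a, y ^ (n - 1) * (y ^ 2 * (y ^ (n + 1))⁻¹) = a := by
  have e : EqOn (fun y : ℝ => y ^ (n - 1) * (y ^ 2 * (y ^ (n + 1))⁻¹)) (fun _ => 1) (Ioo 0 a) :=
    fun y hy => pow_mul_sq_mul_inv_pow hn hy.1
  refine ⟨(integrableOn_congr_fun e measurableSet_Ioo).2 (integrableOn_const (by simp)), ?_⟩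
  rw [setIntegral_congr_fun measurableSet_Ioo e]
  simp [ha.le]

lemma integrableOn_and_integral_inv (hn : 0 < n) {a : ℝ} (ha : 0 < a) (ha1 : a ≤ 1) :
    IntegrableOn (fun y : ℝ => y ^ (n - 1) * (y * (y ^ (n + 1))⁻¹)) (Ico a 1) ∧
      ∫ y in Ico a 1, y ^ (n - 1) * (y * (y ^ (n + 1))⁻¹) = -log a := by
  have e : EqOn (fun y : ℝ => y ^ (n - 1) * (y * (y ^ (n + 1))⁻¹)) (fun y => y⁻¹) (Ico a 1) :=
    fun y hy => pow_mul_mul_inv_pow hn (ha.trans_le hy.1)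
  constructor
  · refine (integrableOn_congr_fun e measurableSet_Ico).2 ?_
    refine (ContinuousOn.integrableOn_Icc (a := a) (b := 1) ?_).mono_set Ico_subset_Icc_self
    exact continuousOn_inv₀.mono fun y hy => (ha.trans_le hy.1).ne'
  · rw [setIntegral_congr_fun measurableSet_Ico e, integral_Ico_eq_integral_Ioc,
      ← intervalIntegral.integral_of_le ha1, integral_inv_of_pos ha one_pos]
    simp [log_inv]

lemma integrableOn_and_integral_inv_sq (hn : 0 < n) {a : ℝ} (ha : 0 < a) :
    IntegrableOn (fun y : ℝ => y ^ (n - 1) * (y ^ (n + 1))⁻¹) (Ici a) ∧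
      ∫ y in Ici a, y ^ (n - 1) * (y ^ (n + 1))⁻¹ = a⁻¹ := by
  have e : EqOn (fun y : ℝ => y ^ (n - 1) * (y ^ (n + 1))⁻¹) (fun y => y ^ (-2 : ℝ)) (Ici a) :=
    fun y hy => pow_mul_inv_pow hn (ha.trans_le hy)
  constructor
  · refine (integrableOn_congr_fun e measurableSet_Ici).2 ?_
    rw [integrableOn_Ici_iff_integrableOn_Ioi]
    exact integrableOn_Ioi_rpow_of_lt (by norm_num) ha
  · rw [setIntegral_congr_fun measurableSet_Ici e, integral_Ici_eq_integral_Ioi,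
      integral_Ioi_rpow_of_lt (by norm_num) ha,
      show (-2 : ℝ) + 1 = -1 by norm_num, rpow_neg_one]
    simp

end Radial

section Upper

variable {n : ℕ} {E : Set (EuclideanSpace ℝ (Fin n))} {ε : ℝ}

/-- The surface area of the unit sphere of `ℝⁿ`. -/
noncomputable def sphereArea (n : ℕ) : ℝ :=
  n * volume.real (Metric.ball (0 : EuclideanSpace ℝ (Fin n)) 1)

lemma volumeReal_ball_pos : 0 < volume.real (Metric.ball (0 : EuclideanSpace ℝ (Fin n)) 1) :=
  ENNReal.toReal_pos (Metric.measure_ball_pos _ _ one_pos).ne' measure_ball_lt_top.ne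

lemma sphereArea_nonneg : 0 ≤ sphereArea n := by
  unfold sphereArea; positivity

lemma lintegral_sq_enorm_mollifyInd_sub_le (hE : MeasurableSet E) (hε : 0 < ε)
    (h : EuclideanSpace ℝ (Fin n)) {c : ℝ}
    (hc : ∀ x, |mollifyInd E ε (x + h) - mollifyInd E ε x| ≤ c) :
    ∫⁻ x, ‖mollifyInd E ε (x + h) - mollifyInd E ε x‖ₑ ^ 2 ≤
      ENNReal.ofReal c * ∫⁻ x, ‖charFn E (x + h) - charFn E x‖ₑ := by
  calc _ ≤ ∫⁻ x, ENNReal.ofReal c * ‖mollifyInd E ε (x + h) - mollifyInd E ε x‖ₑ := by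
        refine lintegral_mono fun x => ?_
        rw [sq]
        gcongr
        rw [Real.enorm_eq_ofReal_abs]
        exact ENNReal.ofReal_le_ofReal (hc x)
    _ = ENNReal.ofReal c * ∫⁻ x, ‖mollifyInd E ε (x + h) - mollifyInd E ε x‖ₑ :=
        lintegral_const_mul' _ _ ENNReal.ofReal_ne_top
    _ ≤ _ := by
        exact mul_le_mul_right (lintegral_enorm_mollifyInd_sub_le hE hε h) _

lemma H12_mollifyInd_le (hn : 0 < n) (hE : HasFinitePerimeter E) (hb : E ⊆ Metric.ball 0 1)
    (hε : 0 < ε) (hε1 : ε < 1) :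
    H12 (mollifyInd E ε) ≤
      ENNReal.ofReal (volume.real (Metric.ball (0 : EuclideanSpace ℝ (Fin n)) 1) *
        (2 * π) ^ (-(n : ℝ) / 2) * perimeter E * sphereArea n) +
      (ENNReal.ofReal (perimeter E * (sphereArea n * ((n + 1) * |log ε|))) +
      2 * volume (Metric.ball (0 : EuclideanSpace ℝ (Fin n)) 1) *
        ENNReal.ofReal (sphereArea n)) := by
  have hP := perimeter_nonneg hE
  set a : ℝ := ε ^ (n + 1) with ha
  have ha0 : 0 < a := by positivity
  have ha1 : a ≤ 1 := pow_le_one₀ hε.le hε1.le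
  set K : ℝ := volume.real (Metric.ball (0 : EuclideanSpace ℝ (Fin n)) 1) *
        (2 * π) ^ (-(n : ℝ) / 2) with hK
  have hK0 : 0 ≤ K := by positivity
  set G : EuclideanSpace ℝ (Fin n) → ENNReal := fun h =>
    (∫⁻ x, ‖mollifyInd E ε (x + h) - mollifyInd E ε x‖ₑ ^ 2) *
      ENNReal.ofReal ((‖h‖ ^ (n + 1))⁻¹) with hG
  have hmeas : ∀ {S : Set ℝ}, MeasurableSet S →
      MeasurableSet {x : EuclideanSpace ℝ (Fin n) | ‖x‖ ∈ S} := fun hS => measurable_norm hS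
  have h1 : ∫⁻ h in {h : EuclideanSpace ℝ (Fin n) | ‖h‖ ∈ Ioo 0 a}, G h ≤
      ENNReal.ofReal (K * perimeter E * sphereArea n) := by
    obtain ⟨i1, i2⟩ := integrableOn_and_integral_sq hn ha0
    have := setLIntegral_radial hn measurableSet_Ioo (fun y (hy : y ∈ Ioo 0 a) => hy.1)
      (fun y hy => by have := hy.1; positivity) i1
    rw [i2] at this
    calc _ ≤ ∫⁻ h in {h : EuclideanSpace ℝ (Fin n) | ‖h‖ ∈ Ioo 0 a},
          ENNReal.ofReal (K * a⁻¹ * perimeter E) *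
            ENNReal.ofReal (‖h‖ ^ 2 * (‖h‖ ^ (n + 1))⁻¹) := by
          refine lintegral_mono fun h => ?_
          refine (mul_le_mul_left ((lintegral_sq_enorm_mollifyInd_sub_le hE.1 hε h
            (c := K * a⁻¹ * ‖h‖) fun x => ?_).trans
              (mul_le_mul_right (lintegral_enorm_translate_sub_le hE hb h) _)) _).trans
              (le_of_eq ?_)
          · simpa using abs_mollifyInd_sub_le hE.1 hb hε (x + h) x
          · rw [← ENNReal.ofReal_mul (by positivity), ← ENNReal.ofReal_mul (by positivity),
              ← ENNReal.ofReal_mul (by positivity)]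
            congr 1
            ring
      _ = _ := by
          rw [lintegral_const_mul' _ _ ENNReal.ofReal_ne_top, this,
            ← ENNReal.ofReal_mul (by positivity), sphereArea]
          congr 1
          field_simp
  have h2 : ∫⁻ h in {h : EuclideanSpace ℝ (Fin n) | ‖h‖ ∈ Ico a 1}, G h ≤
      ENNReal.ofReal (perimeter E * (sphereArea n * ((n + 1) * |log ε|))) := by
    obtain ⟨i1, i2⟩ := integrableOn_and_integral_inv hn ha0 ha1
    have := setLIntegral_radial hn measurableSet_Ico
      (fun y (hy : y ∈ Ico a 1) => ha0.trans_le hy.1)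
      (fun y hy => by have := ha0.trans_le hy.1; positivity) i1
    rw [i2] at this
    calc _ ≤ ∫⁻ h in {h : EuclideanSpace ℝ (Fin n) | ‖h‖ ∈ Ico a 1},
          ENNReal.ofReal (perimeter E) * ENNReal.ofReal (‖h‖ * (‖h‖ ^ (n + 1))⁻¹) := by
          refine lintegral_mono fun h => ?_
          refine (mul_le_mul_left ((lintegral_sq_enorm_mollifyInd_sub_le hE.1 hε h
            (c := 1) fun x => abs_mollifyInd_sub_le_one hE.1 hε _ _).trans
              (mul_le_mul_right (lintegral_enorm_translate_sub_le hE hb h) _)) _).trans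
              (le_of_eq ?_)
          rw [ENNReal.ofReal_one, one_mul, ← ENNReal.ofReal_mul (by positivity),
            ← ENNReal.ofReal_mul (by positivity)]
          congr 1
          ring
      _ = _ := by
          rw [lintegral_const_mul' _ _ ENNReal.ofReal_ne_top, this,
            ← ENNReal.ofReal_mul (by positivity), sphereArea, ha, log_pow,
            abs_of_neg (log_neg hε hε1)]
          push_cast
          congr 1
          ring
  have h3 : ∫⁻ h in {h : EuclideanSpace ℝ (Fin n) | ‖h‖ ∈ Ici (1 : ℝ)}, G h ≤
      2 * volume (Metric.ball (0 : EuclideanSpace ℝ (Fin n)) 1) *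
        ENNReal.ofReal (sphereArea n) := by
    obtain ⟨i1, i2⟩ := integrableOn_and_integral_inv_sq hn one_pos
    have := setLIntegral_radial hn measurableSet_Ici
      (fun y (hy : y ∈ Ici (1 : ℝ)) => (one_pos : (0 : ℝ) < 1).trans_le hy)
      (fun y hy => by have : 0 < y := one_pos.trans_le hy; positivity) i1
    rw [i2, inv_one, mul_one] at this
    calc _ ≤ ∫⁻ h in {h : EuclideanSpace ℝ (Fin n) | ‖h‖ ∈ Ici (1 : ℝ)},
          2 * volume (Metric.ball (0 : EuclideanSpace ℝ (Fin n)) 1) *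
            ENNReal.ofReal ((‖h‖ ^ (n + 1))⁻¹) := by
          refine lintegral_mono fun h => ?_
          refine mul_le_mul_left ((lintegral_sq_enorm_mollifyInd_sub_le hE.1 hε h
            (c := 1) fun x => abs_mollifyInd_sub_le_one hE.1 hε _ _).trans ?_) _
          rw [ENNReal.ofReal_one, one_mul]
          exact lintegral_enorm_translate_sub_le_volume hE.1 hb h
      _ = _ := by
          rw [lintegral_const_mul' _ _ (ENNReal.mul_ne_top (by simp) measure_ball_lt_top.ne),
            this, sphereArea]
  rw [H12_eq_lintegral_translate (continuous_mollifyInd hE.1 hb hε).measurable]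
  have hzero : ∀ h ∉ {h : EuclideanSpace ℝ (Fin n) | ‖h‖ ∈ Ioi (0 : ℝ)}, G h = 0 := by
    intro h hh
    have : h = 0 := by simpa using hh
    simp [hG, this]
  have hcover : {h : EuclideanSpace ℝ (Fin n) | ‖h‖ ∈ Ioi (0 : ℝ)} ⊆
      {h | ‖h‖ ∈ Ioo 0 a} ∪ ({h | ‖h‖ ∈ Ico a 1} ∪ {h | ‖h‖ ∈ Ici (1 : ℝ)}) := by
    intro h (hh : 0 < ‖h‖)
    rcases lt_or_ge ‖h‖ a with h1 | h1
    · exact Or.inl ⟨hh, h1⟩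
    · rcases lt_or_ge ‖h‖ 1 with h2 | h2
      · exact Or.inr (Or.inl ⟨h1, h2⟩)
      · exact Or.inr (Or.inr h2)
  change ∫⁻ h, G h ≤ _
  rw [← setLIntegral_eq_of_support_subset (s := {h | ‖h‖ ∈ Ioi (0 : ℝ)})
    (fun h hh => by_contra fun h0 => hh (hzero h h0))]
  refine (lintegral_mono_set hcover).trans ((lintegral_union_le _ _ _).trans ?_)
  exact add_le_add h1 ((lintegral_union_le _ _ _).trans (add_le_add h2 h3))

lemma tendsto_inv_ofReal_abs_log :
    Tendsto (fun ε : ℝ => (ENNReal.ofReal |log ε|)⁻¹) (nhdsWithin 0 (Ioi 0)) (nhds 0) := by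
  rw [← ENNReal.inv_top]
  refine tendsto_inv_iff.2 (ENNReal.tendsto_ofReal_atTop.comp ?_)
  exact tendsto_abs_atBot_atTop.comp tendsto_log_nhdsGT_zero

lemma limsup_H12_mollifyInd_le (hn : 0 < n) (hE : HasFinitePerimeter E)
    (hb : E ⊆ Metric.ball 0 1) :
    limsup (fun ε : ℝ => (ENNReal.ofReal |log ε|)⁻¹ * H12 (mollifyInd E ε))
      (nhdsWithin 0 (Ioi 0)) ≤ ENNReal.ofReal (sphereArea n * (n + 1) * perimeter E) := by
  have hP := perimeter_nonneg hE
  have hS := sphereArea_nonneg (n := n)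
  set B : ENNReal := ENNReal.ofReal (volume.real (Metric.ball (0 : EuclideanSpace ℝ (Fin n)) 1) *
        (2 * π) ^ (-(n : ℝ) / 2) * perimeter E * sphereArea n) +
      2 * volume (Metric.ball (0 : EuclideanSpace ℝ (Fin n)) 1) *
        ENNReal.ofReal (sphereArea n) with hB
  have hBtop : B ≠ ⊤ := by
    refine ENNReal.add_ne_top.2 ⟨ENNReal.ofReal_ne_top, ?_⟩
    exact ENNReal.mul_ne_top (ENNReal.mul_ne_top (by simp) measure_ball_lt_top.ne)
      ENNReal.ofReal_ne_top
  have hlim : Tendsto (fun ε : ℝ => ENNReal.ofReal (sphereArea n * (n + 1) * perimeter E) +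
      (ENNReal.ofReal |log ε|)⁻¹ * B) (nhdsWithin 0 (Ioi 0))
      (nhds (ENNReal.ofReal (sphereArea n * (n + 1) * perimeter E))) := by
    have := (ENNReal.Tendsto.mul_const tendsto_inv_ofReal_abs_log (Or.inr hBtop)).const_add
      (ENNReal.ofReal (sphereArea n * (n + 1) * perimeter E))
    rwa [zero_mul, add_zero] at this
  rw [← hlim.limsup_eq]
  refine limsup_le_limsup ?_
  filter_upwards [Ioo_mem_nhdsGT (one_pos : (0 : ℝ) < 1)] with ε hε
  have hlog : 0 < |log ε| := abs_pos.2 (log_neg hε.1 hε.2).ne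
  calc _ ≤ (ENNReal.ofReal |log ε|)⁻¹ * (B + ENNReal.ofReal
        (|log ε| * (sphereArea n * (n + 1) * perimeter E))) := by
        gcongr
        refine (H12_mollifyInd_le hn hE hb hε.1 hε.2).trans (le_of_eq ?_)
        rw [hB, add_assoc, add_comm (2 * _ * _)]
        congr 3
        ring
    _ = _ := by
        rw [mul_add, ENNReal.ofReal_mul hlog.le, ← mul_assoc, ENNReal.inv_mul_cancel
          (ENNReal.ofReal_pos.2 hlog).ne' ENNReal.ofReal_ne_top, one_mul, add_comm]

end Upper

section Isotropy

variable {n : ℕ} {g : ℝ → ℝ}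

lemma abs_coord_mul_le (h : EuclideanSpace ℝ (Fin n)) (i j : Fin n) :
    |h i * h j| ≤ ‖h‖ ^ 2 := by
  rw [abs_mul, sq]
  exact mul_le_mul (PiLp.norm_apply_le h i) (PiLp.norm_apply_le h j) (abs_nonneg _)
    (norm_nonneg _)

lemma integrable_coord_mul (hg : Measurable g)
    (hint : Integrable (fun h : EuclideanSpace ℝ (Fin n) => ‖h‖ ^ 2 * g ‖h‖)) (i j : Fin n) :
    Integrable (fun h : EuclideanSpace ℝ (Fin n) => h i * h j * g ‖h‖) := by
  refine hint.mono (Measurable.aestronglyMeasurable (by fun_prop))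
    (Eventually.of_forall fun h => ?_)
  rw [norm_mul, norm_mul (‖h‖ ^ 2), norm_pow, norm_norm]
  exact mul_le_mul_of_nonneg_right (abs_coord_mul_le h i j) (norm_nonneg _)

lemma integral_coord_mul_of_ne {i j : Fin n} (hij : i ≠ j) :
    ∫ h : EuclideanSpace ℝ (Fin n), h i * h j * g ‖h‖ = 0 := by
  let e : EuclideanSpace ℝ (Fin n) ≃ₗᵢ[ℝ] EuclideanSpace ℝ (Fin n) :=
    LinearIsometryEquiv.piLpCongrRight 2 fun k =>
      if k = i then LinearIsometryEquiv.neg ℝ else LinearIsometryEquiv.refl ℝ ℝ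
  have h1 := e.measurePreserving.integral_comp e.toMeasurableEquiv.measurableEmbedding
    (fun h => h i * h j * g ‖h‖)
  have h2 : ∀ h, e h i * e h j * g ‖e h‖ = -(h i * h j * g ‖h‖) := by
    intro h
    rw [e.norm_map]
    simp [e, hij.symm]
  simp_rw [h2, integral_neg] at h1
  linarith

lemma integral_coord_sq_eq (i j : Fin n) :
    ∫ h : EuclideanSpace ℝ (Fin n), h i * h i * g ‖h‖ =
      ∫ h : EuclideanSpace ℝ (Fin n), h j * h j * g ‖h‖ := by
  let e : EuclideanSpace ℝ (Fin n) ≃ₗᵢ[ℝ] EuclideanSpace ℝ (Fin n) :=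
    LinearIsometryEquiv.piLpCongrLeft 2 ℝ ℝ (Equiv.swap i j)
  have h1 := e.measurePreserving.integral_comp e.toMeasurableEquiv.measurableEmbedding
    (fun h => h j * h j * g ‖h‖)
  rw [← h1]
  congr 1
  funext h
  rw [e.norm_map]
  simp [e]

lemma integral_coord_sq (hg : Measurable g)
    (hint : Integrable (fun h : EuclideanSpace ℝ (Fin n) => ‖h‖ ^ 2 * g ‖h‖)) (i : Fin n) :
    n * ∫ h : EuclideanSpace ℝ (Fin n), h i * h i * g ‖h‖ =
      ∫ h : EuclideanSpace ℝ (Fin n), ‖h‖ ^ 2 * g ‖h‖ := by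
  have e : ∀ h : EuclideanSpace ℝ (Fin n), ‖h‖ ^ 2 * g ‖h‖ = ∑ j, h j * h j * g ‖h‖ := by
    intro h
    rw [← Finset.sum_mul, EuclideanSpace.real_norm_sq_eq]
    simp only [sq]
  simp_rw [e]
  rw [integral_finsetSum _ fun j _ => integrable_coord_mul hg hint j j]
  simp [integral_coord_sq_eq (g := g) _ i]

lemma integrable_quadratic_mul (hg : Measurable g)
    (hint : Integrable (fun h : EuclideanSpace ℝ (Fin n) => ‖h‖ ^ 2 * g ‖h‖))
    (q : Fin n → Fin n → ℝ) :
    Integrable (fun h : EuclideanSpace ℝ (Fin n) => (∑ i, ∑ j, h i * h j * q i j) * g ‖h‖) := by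
  simp_rw [Finset.sum_mul]
  refine integrable_finsetSum _ fun i _ => integrable_finsetSum _ fun j _ => ?_
  refine ((integrable_coord_mul hg hint i j).mul_const (q i j)).congr
    (Eventually.of_forall fun h => ?_)
  dsimp only
  ring

lemma integral_quadratic_mul (hn : 0 < n) (hg : Measurable g)
    (hint : Integrable (fun h : EuclideanSpace ℝ (Fin n) => ‖h‖ ^ 2 * g ‖h‖))
    (q : Fin n → Fin n → ℝ) :
    ∫ h : EuclideanSpace ℝ (Fin n), (∑ i, ∑ j, h i * h j * q i j) * g ‖h‖ =
      (∑ i, q i i) / n * ∫ h : EuclideanSpace ℝ (Fin n), ‖h‖ ^ 2 * g ‖h‖ := by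
  have e : ∀ h : EuclideanSpace ℝ (Fin n), (∑ i, ∑ j, h i * h j * q i j) * g ‖h‖ =
      ∑ i, ∑ j, h i * h j * g ‖h‖ * q i j := by
    intro h
    simp_rw [Finset.sum_mul]
    exact Finset.sum_congr rfl fun i _ => Finset.sum_congr rfl fun j _ => by ring
  simp_rw [e]
  rw [integral_finsetSum _ fun i _ => integrable_finsetSum _ fun j _ =>
    (integrable_coord_mul hg hint i j).mul_const _, Finset.sum_div, Finset.sum_mul]
  refine Finset.sum_congr rfl fun i _ => ?_
  rw [integral_finsetSum _ fun j _ => (integrable_coord_mul hg hint i j).mul_const _,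
    Finset.sum_eq_single i]
  · have hn' : (n : ℝ) ≠ 0 := by positivity
    rw [integral_mul_const, ← integral_coord_sq hg hint i]
    field_simp
  · intro j _ hj
    rw [integral_mul_const, integral_coord_mul_of_ne hj.symm, zero_mul]
  · simp

end Isotropy

section Lower

variable {n : ℕ} {E : Set (EuclideanSpace ℝ (Fin n))} {ε : ℝ}

lemma exists_norm_taylor_le {φ : EuclideanSpace ℝ (Fin n) → EuclideanSpace ℝ (Fin n)}
    (hφ : ContDiff ℝ (⊤ : ℕ∞) φ) (hc : HasCompactSupport φ) :
    ∃ C : ℝ, 0 ≤ C ∧ ∀ x h, ‖φ (x - h) - φ x + fderiv ℝ φ x h‖ ≤ C * ‖h‖ ^ 2 := by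
  obtain ⟨C, hC⟩ := ContDiff.lipschitzWith_of_hasCompactSupport (hc.fderiv (𝕜 := ℝ))
    (hφ.fderiv_right (m := (⊤ : ℕ∞)) (by simp)) (by simp)
  refine ⟨C, C.2, fun x h => ?_⟩
  have hd : Differentiable ℝ φ := hφ.differentiable (by simp)
  have := Convex.norm_image_sub_le_of_norm_hasFDerivWithin_le'
    (s := Metric.closedBall x ‖h‖) (f := φ) (f' := fderiv ℝ φ) (φ := fderiv ℝ φ x)
    (C := C * ‖h‖) (x := x) (y := x - h)
    (fun y _ => (hd y).hasFDerivAt.hasFDerivWithinAt) (fun y hy => ?_)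
    (convex_closedBall _ _) (Metric.mem_closedBall_self (norm_nonneg _))
    (by simp)
  · simpa [sq, mul_assoc] using this
  · refine (hC.norm_sub_le y x).trans ?_
    gcongr
    simpa [dist_eq_norm] using hy

/-- The matrix `∫_E ∂ⱼφᵢ`. -/
noncomputable def gradMatrix (E : Set (EuclideanSpace ℝ (Fin n)))
    (φ : EuclideanSpace ℝ (Fin n) → EuclideanSpace ℝ (Fin n)) (i j : Fin n) : ℝ :=
  ∫ x, charFn E x * fderiv ℝ φ x (EuclideanSpace.single j 1) i

lemma integrable_charFn_mul_fderiv_apply (hE : MeasurableSet E) (hfin : volume E ≠ ⊤)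
    {φ : EuclideanSpace ℝ (Fin n) → EuclideanSpace ℝ (Fin n)} (hφ : ContDiff ℝ (⊤ : ℕ∞) φ)
    (hc : HasCompactSupport φ) (i j : Fin n) :
    Integrable (fun x => charFn E x * fderiv ℝ φ x (EuclideanSpace.single j 1) i) := by
  have hcont : Continuous (fderiv ℝ φ) := hφ.continuous_fderiv (by simp)
  obtain ⟨C, hC⟩ := (hc.fderiv (𝕜 := ℝ)).exists_bound_of_continuous hcont
  refine integrable_charFn_mul hE hfin (f := fun x => fderiv ℝ φ x (EuclideanSpace.single j 1) i)
    (by fun_prop) (C := C) fun x => ?_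
  refine (PiLp.norm_apply_le (fderiv ℝ φ x (EuclideanSpace.single j 1)) i).trans ?_
  refine (ContinuousLinearMap.le_opNorm _ _).trans ?_
  simpa using hC x

lemma sum_gradMatrix_diag (hE : MeasurableSet E) (hfin : volume E ≠ ⊤)
    {φ : EuclideanSpace ℝ (Fin n) → EuclideanSpace ℝ (Fin n)} (hφ : ContDiff ℝ (⊤ : ℕ∞) φ)
    (hc : HasCompactSupport φ) :
    ∑ i, gradMatrix E φ i i = ∫ x, charFn E x * diverg φ x := by
  unfold gradMatrix diverg
  rw [← integral_finsetSum _ fun i _ => integrable_charFn_mul_fderiv_apply hE hfin hφ hc i i]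
  simp_rw [Finset.mul_sum]

lemma inner_clm_self_eq_sum (L : EuclideanSpace ℝ (Fin n) →L[ℝ] EuclideanSpace ℝ (Fin n))
    (h : EuclideanSpace ℝ (Fin n)) :
    inner ℝ h (L h) = ∑ i, ∑ j, h i * h j * L (EuclideanSpace.single j 1) i := by
  have hh : h = ∑ j, h j • EuclideanSpace.single j (1 : ℝ) := by
    simpa using ((EuclideanSpace.basisFun (Fin n) ℝ).sum_repr h).symm
  have hL : ∀ i, L h i = ∑ j, h j * L (EuclideanSpace.single j 1) i := by
    intro i
    conv_lhs => rw [hh, map_sum]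
    simp
  rw [PiLp.inner_apply]
  refine Finset.sum_congr rfl fun i _ => ?_
  simp only [hL, RCLike.inner_apply, conj_trivial]
  rw [Finset.sum_mul]
  exact Finset.sum_congr rfl fun j _ => by ring

lemma integrable_and_integral_charFn_mul_inner_fderiv (hE : MeasurableSet E)
    (hfin : volume E ≠ ⊤)
    {φ : EuclideanSpace ℝ (Fin n) → EuclideanSpace ℝ (Fin n)} (hφ : ContDiff ℝ (⊤ : ℕ∞) φ)
    (hc : HasCompactSupport φ) (h : EuclideanSpace ℝ (Fin n)) :
    Integrable (fun x => charFn E x * inner ℝ h (fderiv ℝ φ x h)) ∧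
    ∫ x, charFn E x * inner ℝ h (fderiv ℝ φ x h) =
      ∑ i, ∑ j, h i * h j * gradMatrix E φ i j := by
  have e : ∀ x, charFn E x * inner ℝ h (fderiv ℝ φ x h) =
      ∑ i, ∑ j, h i * h j * (charFn E x * fderiv ℝ φ x (EuclideanSpace.single j 1) i) := by
    intro x
    rw [inner_clm_self_eq_sum, Finset.mul_sum]
    refine Finset.sum_congr rfl fun i _ => ?_
    rw [Finset.mul_sum]
    exact Finset.sum_congr rfl fun j _ => by ring
  have hi : ∀ i j, Integrable (fun x => h i * h j *
      (charFn E x * fderiv ℝ φ x (EuclideanSpace.single j 1) i)) := fun i j =>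
    (integrable_charFn_mul_fderiv_apply hE hfin hφ hc i j).const_mul _
  simp_rw [e]
  refine ⟨integrable_finsetSum _ fun i _ => integrable_finsetSum _ fun j _ => hi i j, ?_⟩
  rw [integral_finsetSum _ fun i _ => integrable_finsetSum _ fun j _ => hi i j]
  refine Finset.sum_congr rfl fun i _ => ?_
  rw [integral_finsetSum _ fun j _ => hi i j]
  exact Finset.sum_congr rfl fun j _ => integral_const_mul _ _

lemma exists_quadratic_le_integral_abs_translate_sub (hE : MeasurableSet E)
    (hfin : volume E ≠ ⊤)
    {φ : EuclideanSpace ℝ (Fin n) → EuclideanSpace ℝ (Fin n)} (hφ : ContDiff ℝ (⊤ : ℕ∞) φ)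
    (hc : HasCompactSupport φ) (h1 : ∀ x, ‖φ x‖ ≤ 1) :
    ∃ C : ℝ, 0 ≤ C ∧ ∀ h : EuclideanSpace ℝ (Fin n), h ≠ 0 →
      (∑ i, ∑ j, h i * h j * gradMatrix E φ i j) * ‖h‖⁻¹ - C * ‖h‖ ^ 2 ≤
        ∫ x, |charFn E (x + h) - charFn E x| := by
  obtain ⟨C, hC0, hC⟩ := exists_norm_taylor_le hφ hc
  refine ⟨C * volume.real E, by positivity, fun h hh => ?_⟩
  have hpos : 0 < ‖h‖ := norm_pos_iff.2 hh
  have hψ : Continuous (fun x => inner ℝ h (φ x)) := continuous_const.inner hφ.continuous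
  have hψ1 : ∀ x, |inner ℝ h (φ x)| ≤ ‖h‖ := fun x =>
    (abs_real_inner_le_norm _ _).trans (mul_le_of_le_one_right hpos.le (h1 x))
  have hshift : Continuous (fun x => inner ℝ h (φ (x - h))) := hψ.comp (by fun_prop)
  have hT := integral_translate_sub_mul hE hfin hψ hψ1 h
  have i1 := integrable_charFn_mul hE hfin hψ hψ1
  have i2 := integrable_charFn_mul hE hfin hshift fun x => hψ1 (x - h)
  obtain ⟨i3, hQ⟩ := integrable_and_integral_charFn_mul_inner_fderiv hE hfin hφ hc h
  have hw := integrable_charFn_translate_sub hE hfin h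
  have hlow : -(‖h‖ * ∫ x, |charFn E (x + h) - charFn E x|) ≤
      ∫ x, (charFn E (x + h) - charFn E x) * inner ℝ h (φ x) := by
    rw [← integral_const_mul, ← integral_neg]
    refine integral_mono (hw.abs.const_mul _).neg
      (hw.mul_bdd hψ.aestronglyMeasurable (Eventually.of_forall hψ1)) fun x => ?_
    refine (neg_le_of_abs_le ?_)
    rw [abs_mul, mul_comm]
    exact mul_le_mul_of_nonneg_right (hψ1 x) (abs_nonneg _)
  have hup : (∫ x, charFn E x * inner ℝ h (φ (x - h))) - (∫ x, charFn E x * inner ℝ h (φ x)) +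
      ∑ i, ∑ j, h i * h j * gradMatrix E φ i j ≤ volume.real E * (‖h‖ * (C * ‖h‖ ^ 2)) := by
    have e : ∫ x, charFn E x * (‖h‖ * (C * ‖h‖ ^ 2)) =
        volume.real E * (‖h‖ * (C * ‖h‖ ^ 2)) := by
      rw [integral_mul_const, charFn, integral_indicator_const _ hE]; simp
    have i4 : Integrable (fun x => charFn E x * inner ℝ h (φ (x - h)) -
        charFn E x * inner ℝ h (φ x)) := i2.sub i1
    rw [← hQ, ← integral_sub i2 i1, ← integral_add i4 i3, ← e]
    refine integral_mono (i4.add i3) ((integrable_charFn hE hfin).mul_const _)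
      fun x => ?_
    dsimp only
    rw [← mul_sub, ← mul_add, ← inner_sub_right, ← inner_add_right]
    refine mul_le_mul_of_nonneg_left ?_ (charFn_nonneg x)
    exact (real_inner_le_norm _ _).trans (mul_le_mul_of_nonneg_left (hC x h) hpos.le)
  rw [sub_le_iff_le_add, ← div_eq_mul_inv, div_le_iff₀ hpos]
  nlinarith

lemma ofReal_integral_le_lintegral_ofReal {α : Type*} [MeasurableSpace α] {μ : Measure α}
    {f : α → ℝ} (hf : Integrable f μ) :
    ENNReal.ofReal (∫ x, f x ∂μ) ≤ ∫⁻ x, ENNReal.ofReal (f x) ∂μ := by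
  calc _ ≤ ENNReal.ofReal (∫ x, max (f x) 0 ∂μ) :=
        ENNReal.ofReal_le_ofReal (integral_mono hf hf.pos_part fun x => le_max_left _ _)
    _ = ∫⁻ x, ENNReal.ofReal (max (f x) 0) ∂μ :=
        ofReal_integral_eq_lintegral_ofReal hf.pos_part
          (Eventually.of_forall fun x => le_max_right _ _)
    _ = _ := by simp [ENNReal.ofReal_max]

lemma exists_ofReal_le_setLIntegral_translate_sub (hn : 0 < n) (hE : MeasurableSet E)
    (hfin : volume E ≠ ⊤)
    {φ : EuclideanSpace ℝ (Fin n) → EuclideanSpace ℝ (Fin n)} (hφ : ContDiff ℝ (⊤ : ℕ∞) φ)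
    (hc : HasCompactSupport φ) (h1 : ∀ x, ‖φ x‖ ≤ 1) :
    ∃ C : ℝ, 0 ≤ C ∧ ∀ ε : ℝ, 0 < ε → ε < 1 →
      ENNReal.ofReal (volume.real (Metric.ball (0 : EuclideanSpace ℝ (Fin n)) 1) *
        (∫ x, charFn E x * diverg φ x) * |log ε| - C) ≤
      ∫⁻ h in {h : EuclideanSpace ℝ (Fin n) | ‖h‖ ∈ Ico ε 1},
        (∫⁻ x, ‖charFn E (x + h) - charFn E x‖ₑ) * ENNReal.ofReal ((‖h‖ ^ (n + 1))⁻¹) := by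
  obtain ⟨C, hC0, hC⟩ := exists_quadratic_le_integral_abs_translate_sub hE hfin hφ hc h1
  refine ⟨C * sphereArea n, mul_nonneg hC0 sphereArea_nonneg, fun ε hε hε1 => ?_⟩
  set g : ℝ → ℝ := (Ico ε 1).indicator fun r => r⁻¹ * (r ^ (n + 1))⁻¹ with hg
  set k : ℝ → ℝ := (Ioo 0 1).indicator fun r => r ^ 2 * (r ^ (n + 1))⁻¹ with hk
  have hgm : Measurable g := Measurable.indicator (by fun_prop) measurableSet_Ico
  have hA : MeasurableSet {h : EuclideanSpace ℝ (Fin n) | ‖h‖ ∈ Ico ε 1} :=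
    measurable_norm measurableSet_Ico
  have hB : MeasurableSet {h : EuclideanSpace ℝ (Fin n) | ‖h‖ ∈ Ioo (0 : ℝ) 1} :=
    measurable_norm measurableSet_Ioo
  have eg : (fun h : EuclideanSpace ℝ (Fin n) => ‖h‖ ^ 2 * g ‖h‖) =
      {h : EuclideanSpace ℝ (Fin n) | ‖h‖ ∈ Ico ε 1}.indicator
        fun h => ‖h‖ * (‖h‖ ^ (n + 1))⁻¹ := by
    funext h
    by_cases hh : ‖h‖ ∈ Ico ε 1
    · have : ‖h‖ ≠ 0 := (hε.trans_le hh.1).ne'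
      rw [indicator_of_mem (show h ∈ {h | ‖h‖ ∈ Ico ε 1} from hh), hg, indicator_of_mem hh]
      field_simp
    · rw [indicator_of_notMem (show h ∉ {h | ‖h‖ ∈ Ico ε 1} from hh), hg,
        indicator_of_notMem hh, mul_zero]
  have ek : (fun h : EuclideanSpace ℝ (Fin n) => k ‖h‖) =
      {h : EuclideanSpace ℝ (Fin n) | ‖h‖ ∈ Ioo (0 : ℝ) 1}.indicator
        fun h => ‖h‖ ^ 2 * (‖h‖ ^ (n + 1))⁻¹ := rfl
  obtain ⟨g1, g2⟩ := integrableOn_and_integral_inv hn hε hε1.le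
  obtain ⟨g3, g4⟩ := integrableOn_setIntegral_radial hn measurableSet_Ico
    (fun y (hy : y ∈ Ico ε 1) => hε.trans_le hy.1) (f := fun y => y * (y ^ (n + 1))⁻¹) g1
  obtain ⟨k1, k2⟩ := integrableOn_and_integral_sq hn one_pos
  obtain ⟨k3, k4⟩ := integrableOn_setIntegral_radial hn measurableSet_Ioo
    (fun y (hy : y ∈ Ioo (0 : ℝ) 1) => hy.1) (f := fun y => y ^ 2 * (y ^ (n + 1))⁻¹) k1
  have hgi : Integrable (fun h : EuclideanSpace ℝ (Fin n) => ‖h‖ ^ 2 * g ‖h‖) := by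
    rw [eg]; exact (integrable_indicator_iff hA).2 g3
  have hki : Integrable (fun h : EuclideanSpace ℝ (Fin n) => k ‖h‖) := by
    rw [ek]; exact (integrable_indicator_iff hB).2 k3
  have hqi := integrable_quadratic_mul hgm hgi (gradMatrix E φ)
  have hval : ∫ h : EuclideanSpace ℝ (Fin n),
      ((∑ i, ∑ j, h i * h j * gradMatrix E φ i j) * g ‖h‖ - C * k ‖h‖) =
      volume.real (Metric.ball (0 : EuclideanSpace ℝ (Fin n)) 1) *
        (∫ x, charFn E x * diverg φ x) * |log ε| - C * sphereArea n := by
    rw [integral_sub hqi (hki.const_mul C), integral_quadratic_mul hn hgm hgi,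
      sum_gradMatrix_diag hE hfin hφ hc, eg, integral_indicator hA, g4, g2,
      integral_const_mul, ek, integral_indicator hB, k4, k2, sphereArea, mul_one,
      abs_of_neg (log_neg hε hε1)]
    field_simp
  have hF : Integrable (fun h : EuclideanSpace ℝ (Fin n) =>
      (∑ i, ∑ j, h i * h j * gradMatrix E φ i j) * g ‖h‖ - C * k ‖h‖) :=
    hqi.sub (hki.const_mul C)
  rw [← hval]
  refine (ofReal_integral_le_lintegral_ofReal hF).trans ?_
  rw [← lintegral_indicator hA]
  refine lintegral_mono fun h => ?_
  by_cases hh : ‖h‖ ∈ Ico ε 1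
  · have hpos : 0 < ‖h‖ := hε.trans_le hh.1
    rw [indicator_of_mem (show h ∈ {h | ‖h‖ ∈ Ico ε 1} from hh), hg, hk, indicator_of_mem hh,
      indicator_of_mem (show ‖h‖ ∈ Ioo (0 : ℝ) 1 from ⟨hpos, hh.2⟩),
      ← ofReal_integral_norm_eq_lintegral_enorm (integrable_charFn_translate_sub hE hfin h),
      ← ENNReal.ofReal_mul (integral_nonneg fun _ => norm_nonneg _)]
    refine ENNReal.ofReal_le_ofReal ?_
    have := mul_le_mul_of_nonneg_right (hC h (norm_pos_iff.1 hpos))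
      (by positivity : 0 ≤ (‖h‖ ^ (n + 1))⁻¹)
    refine le_trans (le_of_eq ?_) this
    ring
  · rw [indicator_of_notMem (show h ∉ {h | ‖h‖ ∈ Ico ε 1} from hh), hg,
      indicator_of_notMem hh, mul_zero, zero_sub]
    refine (ENNReal.ofReal_of_nonpos (neg_nonpos.2 (mul_nonneg hC0 ?_))).le
    exact indicator_nonneg (fun r (hr : r ∈ Ioo (0 : ℝ) 1) => by have := hr.1; positivity) _

lemma abs_charFn_sub_le_mollifyInd (hE : MeasurableSet E) (hε : 0 < ε)
    (x y : EuclideanSpace ℝ (Fin n)) :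
    |charFn E x - charFn E y| ≤ 2 * |mollifyInd E ε x - mollifyInd E ε y| ^ 2 +
      (4 * |charFn E x - mollifyInd E ε x| + 4 * |charFn E y - mollifyInd E ε y|) := by
  have h1 := abs_charFn_sub_mollifyInd_le_one hE hε x
  have h2 := abs_charFn_sub_mollifyInd_le_one hE hε y
  have h3 : ∀ {a : ℝ}, |a| ≤ 1 → a ^ 2 ≤ |a| := fun {a} ha => by
    rw [← sq_abs]; nlinarith [abs_nonneg a]
  rw [← abs_charFn_sub_sq, sq_abs]
  have h4 := h3 h1
  have h5 := h3 h2
  set a := charFn E x - mollifyInd E ε x with ha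
  set b := charFn E y - mollifyInd E ε y with hb
  set m := mollifyInd E ε x - mollifyInd E ε y with hm
  have e : charFn E x - charFn E y = m + (a - b) := by rw [ha, hb, hm]; ring
  rw [e]
  nlinarith [sq_nonneg (m - (a - b)), sq_nonneg (a + b)]

lemma lintegral_enorm_translate_sub_le_mollifyInd (hE : MeasurableSet E)
    (hb : E ⊆ Metric.ball 0 1) (hε : 0 < ε) (h : EuclideanSpace ℝ (Fin n)) :
    ∫⁻ x, ‖charFn E (x + h) - charFn E x‖ₑ ≤
      2 * (∫⁻ x, ‖mollifyInd E ε (x + h) - mollifyInd E ε x‖ₑ ^ 2) +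
        8 * ∫⁻ x, ‖charFn E x - mollifyInd E ε x‖ₑ := by
  have hm := measurable_charFn hE
  have hm' := (continuous_mollifyInd hE hb hε).measurable
  calc _ ≤ ∫⁻ x, (2 * ‖mollifyInd E ε (x + h) - mollifyInd E ε x‖ₑ ^ 2 +
        (4 * ‖charFn E (x + h) - mollifyInd E ε (x + h)‖ₑ +
          4 * ‖charFn E x - mollifyInd E ε x‖ₑ)) := by
        refine lintegral_mono fun x => ?_
        have := ENNReal.ofReal_le_ofReal (abs_charFn_sub_le_mollifyInd hE hε (x + h) x)
        rw [ENNReal.ofReal_add (by positivity) (by positivity),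
          ENNReal.ofReal_add (by positivity) (by positivity),
          ENNReal.ofReal_mul (by positivity), ENNReal.ofReal_mul (by positivity),
          ENNReal.ofReal_mul (by positivity), ENNReal.ofReal_pow (abs_nonneg _)] at this
        simpa [Real.enorm_eq_ofReal_abs] using this
    _ = 2 * (∫⁻ x, ‖mollifyInd E ε (x + h) - mollifyInd E ε x‖ₑ ^ 2) +
        (4 * (∫⁻ x, ‖charFn E x - mollifyInd E ε x‖ₑ) +
          4 * ∫⁻ x, ‖charFn E x - mollifyInd E ε x‖ₑ) := by
        rw [lintegral_add_left (by fun_prop), lintegral_add_left (by fun_prop),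
          lintegral_const_mul _ (by fun_prop), lintegral_const_mul _ (by fun_prop),
          lintegral_const_mul _ (by fun_prop),
          lintegral_add_right_eq_self (fun x => ‖charFn E x - mollifyInd E ε x‖ₑ)]
    _ = _ := by
        rw [← add_mul]; norm_num

lemma setLIntegral_translate_sub_le_H12 (hn : 0 < n) (hE : HasFinitePerimeter E)
    (hb : E ⊆ Metric.ball 0 1) :
    ∃ C : ℝ, 0 ≤ C ∧ ∀ ε : ℝ, 0 < ε →
      ∫⁻ h in {h : EuclideanSpace ℝ (Fin n) | ‖h‖ ∈ Ico ε 1},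
        (∫⁻ x, ‖charFn E (x + h) - charFn E x‖ₑ) * ENNReal.ofReal ((‖h‖ ^ (n + 1))⁻¹) ≤
      2 * H12 (mollifyInd E ε) + ENNReal.ofReal C := by
  have hP := perimeter_nonneg hE
  set M : ℝ := ∫ y : EuclideanSpace ℝ (Fin n), ‖y‖ * gaussian n y with hM
  have hM0 : 0 ≤ M := integral_nonneg fun y => mul_nonneg (norm_nonneg _) (gaussian_nonneg y)
  have hS := sphereArea_nonneg (n := n)
  refine ⟨8 * (perimeter E * M * sphereArea n), by positivity, fun ε hε => ?_⟩
  obtain ⟨i1, i2⟩ := integrableOn_and_integral_inv_sq hn hε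
  have hrad := setLIntegral_radial hn measurableSet_Ici
    (fun y (hy : y ∈ Ici ε) => hε.trans_le hy)
    (fun y hy => by have : 0 < y := hε.trans_le hy; positivity) i1
  rw [i2] at hrad
  set A := ∫⁻ x, ‖charFn E x - mollifyInd E ε x‖ₑ with hA
  have hAle : A ≤ ENNReal.ofReal (perimeter E * (ε * M)) :=
    lintegral_enorm_charFn_sub_mollifyInd_le hE hb hε
  have hAtop : A ≠ ⊤ := ne_top_of_le_ne_top ENNReal.ofReal_ne_top hAle
  have hmr : Measurable fun h : EuclideanSpace ℝ (Fin n) =>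
      8 * A * ENNReal.ofReal ((‖h‖ ^ (n + 1))⁻¹) := by fun_prop
  calc _ ≤ ∫⁻ h in {h : EuclideanSpace ℝ (Fin n) | ‖h‖ ∈ Ico ε 1},
        (2 * ((∫⁻ x, ‖mollifyInd E ε (x + h) - mollifyInd E ε x‖ₑ ^ 2) *
          ENNReal.ofReal ((‖h‖ ^ (n + 1))⁻¹)) +
          8 * A * ENNReal.ofReal ((‖h‖ ^ (n + 1))⁻¹)) := by
        refine lintegral_mono fun h => ?_
        dsimp only
        rw [← mul_assoc, ← add_mul]
        gcongr
        exact lintegral_enorm_translate_sub_le_mollifyInd hE.1 hb hε h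
    _ = (∫⁻ h in {h : EuclideanSpace ℝ (Fin n) | ‖h‖ ∈ Ico ε 1},
        2 * ((∫⁻ x, ‖mollifyInd E ε (x + h) - mollifyInd E ε x‖ₑ ^ 2) *
          ENNReal.ofReal ((‖h‖ ^ (n + 1))⁻¹))) +
        ∫⁻ h in {h : EuclideanSpace ℝ (Fin n) | ‖h‖ ∈ Ico ε 1},
          8 * A * ENNReal.ofReal ((‖h‖ ^ (n + 1))⁻¹) := lintegral_add_right _ hmr
    _ ≤ (∫⁻ h, 2 * ((∫⁻ x, ‖mollifyInd E ε (x + h) - mollifyInd E ε x‖ₑ ^ 2) *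
          ENNReal.ofReal ((‖h‖ ^ (n + 1))⁻¹))) +
        ∫⁻ h in {h : EuclideanSpace ℝ (Fin n) | ‖h‖ ∈ Ici ε},
          8 * A * ENNReal.ofReal ((‖h‖ ^ (n + 1))⁻¹) :=
        add_le_add (setLIntegral_le_lintegral _ _) (lintegral_mono_set fun h hh => hh.1)
    _ ≤ _ := by
        rw [lintegral_const_mul' _ _ (by simp), lintegral_const_mul' _ _
          (ENNReal.mul_ne_top (by simp) hAtop), hrad, H12_eq_lintegral_translate
          (continuous_mollifyInd hE.1 hb hε).measurable]
        gcongr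
        calc _ ≤ 8 * ENNReal.ofReal (perimeter E * (ε * M)) * ENNReal.ofReal
              (sphereArea n * ε⁻¹) := by
              rw [sphereArea]; gcongr
          _ = _ := by
              rw [show (8 : ENNReal) = ENNReal.ofReal 8 by simp,
                ← ENNReal.ofReal_mul (by positivity), ← ENNReal.ofReal_mul (by positivity)]
              congr 1
              field_simp

lemma ofReal_le_liminf_H12_mollifyInd (hn : 0 < n) (hE : HasFinitePerimeter E)
    (hb : E ⊆ Metric.ball 0 1)
    {φ : EuclideanSpace ℝ (Fin n) → EuclideanSpace ℝ (Fin n)} (hφ : ContDiff ℝ (⊤ : ℕ∞) φ)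
    (hc : HasCompactSupport φ) (h1 : ∀ x, ‖φ x‖ ≤ 1) :
    ENNReal.ofReal (volume.real (Metric.ball (0 : EuclideanSpace ℝ (Fin n)) 1) / 2 *
        ∫ x, charFn E x * diverg φ x) ≤
      liminf (fun ε : ℝ => (ENNReal.ofReal |log ε|)⁻¹ * H12 (mollifyInd E ε))
        (nhdsWithin 0 (Ioi 0)) := by
  have hfin : volume E ≠ ⊤ := measure_ne_top_of_subset hb measure_ball_lt_top.ne
  obtain ⟨C, hC0, hC⟩ := exists_ofReal_le_setLIntegral_translate_sub hn hE.1 hfin hφ hc h1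
  obtain ⟨C', hC0', hC'⟩ := setLIntegral_translate_sub_le_H12 hn hE hb
  set ω := volume.real (Metric.ball (0 : EuclideanSpace ℝ (Fin n)) 1)
  set r := ∫ x, charFn E x * diverg φ x
  have hlim : Tendsto (fun ε : ℝ => ENNReal.ofReal (ω / 2 * r - (C + C') / 2 * |log ε|⁻¹))
      (nhdsWithin 0 (Ioi 0)) (nhds (ENNReal.ofReal (ω / 2 * r))) := by
    refine (ENNReal.continuous_ofReal.tendsto _).comp ?_
    have := ((tendsto_inv_atTop_zero.comp (tendsto_abs_atBot_atTop.comp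
      tendsto_log_nhdsGT_zero)).const_mul ((C + C') / 2)).const_sub (ω / 2 * r)
    rwa [mul_zero, sub_zero] at this
  rw [← hlim.liminf_eq]
  refine liminf_le_liminf ?_
  filter_upwards [Ioo_mem_nhdsGT (one_pos : (0 : ℝ) < 1)] with ε hε
  have hlog : 0 < |log ε| := abs_pos.2 (log_neg hε.1 hε.2).ne
  have key : ENNReal.ofReal (ω * r * |log ε| - C - C') ≤ 2 * H12 (mollifyInd E ε) := by
    rw [ENNReal.ofReal_sub _ hC0']
    exact tsub_le_iff_right.2 ((hC ε hε.1 hε.2).trans (hC' ε hε.1))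
  calc _ = ENNReal.ofReal (|log ε|⁻¹ * (1 / 2) * (ω * r * |log ε| - C - C')) := by
        congr 1
        field_simp
        ring
    _ = (ENNReal.ofReal |log ε|)⁻¹ * (2⁻¹ * ENNReal.ofReal (ω * r * |log ε| - C - C')) := by
        have h2 : ENNReal.ofReal (1 / 2) = 2⁻¹ := by
          rw [one_div, ENNReal.ofReal_inv_of_pos two_pos]; simp
        rw [ENNReal.ofReal_mul (by positivity), ENNReal.ofReal_mul (by positivity),
          ENNReal.ofReal_inv_of_pos hlog, mul_assoc, h2]
    _ ≤ (ENNReal.ofReal |log ε|)⁻¹ * (2⁻¹ * (2 * H12 (mollifyInd E ε))) := by gcongr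
    _ = _ := by
        rw [← mul_assoc 2⁻¹, ENNReal.inv_mul_cancel (by simp) (by simp), one_mul]

lemma perimeter_le_liminf_H12_mollifyInd (hn : 0 < n) (hE : HasFinitePerimeter E)
    (hb : E ⊆ Metric.ball 0 1) :
    ENNReal.ofReal (volume.real (Metric.ball (0 : EuclideanSpace ℝ (Fin n)) 1) / 2 *
        perimeter E) ≤
      liminf (fun ε : ℝ => (ENNReal.ofReal |log ε|)⁻¹ * H12 (mollifyInd E ε))
        (nhdsWithin 0 (Ioi 0)) := by
  set L := liminf (fun ε : ℝ => (ENNReal.ofReal |log ε|)⁻¹ * H12 (mollifyInd E ε))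
        (nhdsWithin 0 (Ioi 0)) with hL
  rcases eq_or_ne L ⊤ with htop | htop
  · rw [htop]; exact le_top
  have hω : 0 < volume.real (Metric.ball (0 : EuclideanSpace ℝ (Fin n)) 1) / 2 :=
    half_pos volumeReal_ball_pos
  rw [ENNReal.ofReal_le_iff_le_toReal htop, ← le_div_iff₀' hω]
  refine csSup_le ⟨0, fun _ => 0, contDiff_const, HasCompactSupport.zero, by simp,
    by simp [diverg]⟩ ?_
  rintro r ⟨φ, hφ, hc, h1, rfl⟩
  rw [le_div_iff₀' hω, ← ENNReal.ofReal_le_iff_le_toReal htop]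
  exact ofReal_le_liminf_H12_mollifyInd hn hE hb hφ hc h1

end Lower

/-- Theorem 1.2: for `E ⊆ B₁` of finite perimeter and `φ_ε = 1_E ∗ γ_{n,ε}`, both the
`limsup` and the `liminf` of `|log ε|⁻¹ ‖φ_ε‖²_{H^{1/2}}` as `ε → 0` are comparable, with
dimensional constants, to the perimeter `∫ |∇1_E|`. -/
theorem H12_comparable_perimeter {n : ℕ} :
    ∃ c C : ℝ, 0 < c ∧ 0 < C ∧ ∀ E : Set (EuclideanSpace ℝ (Fin n)),
      E ⊆ Metric.ball 0 1 → HasFinitePerimeter E →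
      ENNReal.ofReal (c * perimeter E) ≤
          liminf (fun ε : ℝ => (ENNReal.ofReal |log ε|)⁻¹ * H12 (mollifyInd E ε))
            (nhdsWithin 0 (Ioi 0)) ∧
      limsup (fun ε : ℝ => (ENNReal.ofReal |log ε|)⁻¹ * H12 (mollifyInd E ε))
            (nhdsWithin 0 (Ioi 0)) ≤
          ENNReal.ofReal (C * perimeter E) := by
  rcases Nat.eq_zero_or_pos n with rfl | hn
  · refine ⟨1, 1, one_pos, one_pos, fun E _ hE => ?_⟩
    have hP : perimeter E ≤ 0 := by
      refine csSup_le ⟨0, fun _ => 0, contDiff_const, HasCompactSupport.zero, by simp,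
        by simp [diverg]⟩ ?_
      rintro r ⟨φ, -, -, -, rfl⟩
      simp [diverg]
    have hH : ∀ ε : ℝ, H12 (mollifyInd E ε) = 0 := by
      intro ε
      have : ∀ x y : EuclideanSpace ℝ (Fin 0), x - y = 0 := fun x y => Subsingleton.elim _ _
      simp [H12, this]
    simp [hH, ENNReal.ofReal_of_nonpos hP]
  · refine ⟨volume.real (Metric.ball (0 : EuclideanSpace ℝ (Fin n)) 1) / 2,
      sphereArea n * (n + 1), half_pos volumeReal_ball_pos, ?_, fun E hb hE =>
      ⟨perimeter_le_liminf_H12_mollifyInd hn hE hb, limsup_H12_mollifyInd_le hn hE hb⟩⟩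
    have := volumeReal_ball_pos (n := n)
    unfold sphereArea
    positivity
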